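/- arXiv:1812.01174 — 4 statements merged into one kernel-verified Lean document; each statement's English description precedes it below -/
import Mathlib

section
/- Suppose T satisfies a shifted mixing local limit theorem at some scale (L_n). Then T is global-global mixing (of type 3) with respect to 𝔾_U: for all pairs (Φ₁, Φ̄₁), (Φ₂, Φ̄₂) ∈ 𝔾_U, both the limsup and the liminf, taken over cubes C ⊂ ℝ^d whose side length tends to ∞, of (1/μ(V_C)) ∫_{V_C} Φ₁ · (Φ₂ ∘ T^n) dμ converge to Φ̄₁ · Φ̄₂ as n → ∞. -/
open MeasureTheory Filter Topology

noncomputable section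

/-- Euclidean norm of a vector in `ℝ^d`. -/
def rnorm {d : ℕ} (z : Fin d → ℝ) : ℝ := Real.sqrt (∑ i, (z i) ^ 2)

/-- Euclidean norm of a lattice point in `ℤ^d`. -/
def znorm {d : ℕ} (z : Fin d → ℤ) : ℝ := rnorm (fun i => (z i : ℝ))

variable {d : ℕ} {M : Type*}

/-- The Birkhoff sums `τ_n(y) = ∑_{j<n} τ(f^j y)`. -/
def tauSum (f : M → M) (τ : M → Fin d → ℤ) (n : ℕ) (y : M) : Fin d → ℤ :=
  ∑ j ∈ Finset.range n, τ (f^[j] y)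

/-- The skew product `T(y,z) = (f(y), z + τ(y))` on `X = M × ℤ^d`. -/
def skewT (f : M → M) (τ : M → Fin d → ℤ) : M × (Fin d → ℤ) → M × (Fin d → ℤ) :=
  fun x => (f x.1, x.2 + τ x.1)

/-- The measure `μ = ν ⊗ (counting measure on ℤ^d)` on `X = M × ℤ^d`. -/
def skewMeas [MeasurableSpace M] (ν : Measure M) : Measure (M × (Fin d → ℤ)) :=
  ν.prod (Measure.count : Measure (Fin d → ℤ))

/-- `V_B = M × (B ∩ ℤ^d)` for the box `B = ∏_i [a i, b i] ⊆ ℝ^d`. -/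
def VBox (M : Type*) (a b : Fin d → ℝ) : Set (M × (Fin d → ℤ)) :=
  {x | ∀ i, a i ≤ (x.2 i : ℝ) ∧ (x.2 i : ℝ) ≤ b i}

/-- `V_C` for the cube `C` with lower corner `a` and side length `s`. -/
def VCube (M : Type*) (a : Fin d → ℝ) (s : ℝ) : Set (M × (Fin d → ℤ)) :=
  VBox M a (fun i => a i + s)

/-- Membership in `𝔾_O`:  `Φ` is bounded, uniformly continuous, and has average `Φbar`
along dilations of any fixed box. -/
def memGO [MetricSpace M] [MeasurableSpace M] (μ : Measure (M × (Fin d → ℤ)))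
    (Φ : M × (Fin d → ℤ) → ℝ) (Φbar : ℝ) : Prop :=
  (∃ C, ∀ x, |Φ x| ≤ C) ∧ UniformContinuous Φ ∧
    ∀ a b : Fin d → ℝ, (∀ i, a i < b i) →
      Tendsto (fun N : ℝ =>
          (1 / (N ^ d * ∏ i, (b i - a i))) *
            ∫ x in VBox M (fun i => a i * N) (fun i => b i * N), Φ x ∂μ)
        atTop (𝓝 Φbar)

/-- Membership in `𝔾_U`: `Φ` is bounded, uniformly continuous, and has average `Φbar`
uniformly over all large cubes. -/
def memGU [MetricSpace M] [MeasurableSpace M] (μ : Measure (M × (Fin d → ℤ)))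
    (Φ : M × (Fin d → ℤ) → ℝ) (Φbar : ℝ) : Prop :=
  (∃ C, ∀ x, |Φ x| ≤ C) ∧ UniformContinuous Φ ∧
    ∀ ε > (0 : ℝ), ∃ N₀ : ℝ, ∀ (a : Fin d → ℝ) (s : ℝ), N₀ ≤ s →
      |(μ (VCube M a s)).toReal⁻¹ * (∫ x in VCube M a s, Φ x ∂μ) - Φbar| ≤ ε

/-- The average of `F` over `V_C`, where the cube `C` is encoded by (lower corner, side length). -/
def cubeAvg [MeasurableSpace M] (μ : Measure (M × (Fin d → ℤ)))
    (F : M × (Fin d → ℤ) → ℝ) (c : (Fin d → ℝ) × ℝ) : ℝ :=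
  (μ (VCube M c.1 c.2)).toReal⁻¹ * ∫ x in VCube M c.1 c.2, F x ∂μ

/-- The filter of cubes (encoded by (lower corner, side length)) whose side length
tends to infinity. -/
def cubeFilter (d : ℕ) : Filter ((Fin d → ℝ) × ℝ) := Filter.comap Prod.snd atTop

/-- The mixing local limit theorem (MLLT) at scale `L` with limiting density `p`. -/
def MLLT [TopologicalSpace M] [MeasurableSpace M] (ν : Measure M) (f : M → M) (τ : M → Fin d → ℤ)
    (L : ℕ → ℝ) (p : (Fin d → ℝ) → ℝ) : Prop :=
  Tendsto L atTop atTop ∧ Continuous p ∧ (∀ z, 0 ≤ p z) ∧ (∫ z : Fin d → ℝ, p z) = 1 ∧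
    ∀ φ₁ φ₂ : M → ℝ, Continuous φ₁ → Continuous φ₂ →
      (∃ C, ∀ y, |φ₁ y| ≤ C) → (∃ C, ∀ y, |φ₂ y| ≤ C) →
      ∀ z0 : ℕ → Fin d → ℤ,
        Tendsto (fun n => fun i => (z0 n i : ℝ) / L n) atTop (𝓝 0) →
      ∀ K : ℝ, ∀ ε > (0 : ℝ), ∃ N, ∀ n ≥ N, ∀ z : Fin d → ℝ, rnorm z ≤ K →
        |(L n) ^ d *
            (∫ y, (if tauSum f τ n y = z0 n + (fun i => ⌊z i * L n⌋) then
              φ₁ y * φ₂ (f^[n] y) else 0) ∂ν) -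
          (∫ y, φ₁ y ∂ν) * (∫ y, φ₂ y ∂ν) * p z| ≤ ε

/-- The shifted mixing local limit theorem at scale `L` with limiting density `p`. -/
def ShiftedMLLT [TopologicalSpace M] [MeasurableSpace M] (ν : Measure M) (f : M → M) (τ : M → Fin d → ℤ)
    (L : ℕ → ℝ) (p : (Fin d → ℝ) → ℝ) : Prop :=
  Tendsto L atTop atTop ∧ Continuous p ∧ (∀ z, 0 ≤ p z) ∧ (∫ z : Fin d → ℝ, p z) = 1 ∧
    ∃ D : ℕ → Fin d → ℝ,
    ∀ φ₁ φ₂ : M → ℝ, Continuous φ₁ → Continuous φ₂ →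
      (∃ C, ∀ y, |φ₁ y| ≤ C) → (∃ C, ∀ y, |φ₂ y| ≤ C) →
      ∀ z0 : ℕ → Fin d → ℤ,
        Tendsto (fun n => fun i => ((z0 n i : ℝ) - D n i) / L n) atTop (𝓝 0) →
      ∀ K : ℝ, ∀ ε > (0 : ℝ), ∃ N, ∀ n ≥ N, ∀ z : Fin d → ℝ, rnorm z ≤ K →
        |(L n) ^ d *
            (∫ y, (if tauSum f τ n y = z0 n + (fun i => ⌊z i * L n⌋) then
              φ₁ y * φ₂ (f^[n] y) else 0) ∂ν) -
          (∫ y, φ₁ y ∂ν) * (∫ y, φ₂ y ∂ν) * p z| ≤ ε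

end

/-- **Ulam's theorem**: on a set linearly ordered with countable initial segments, a σ-ideal that
contains the countable sets and has the countable chain condition is improper. -/
theorem ulam_sigmaIdeal {W : Type*} (r : W → W → Prop)
    (htri : ∀ v w, r v w ∨ v = w ∨ r w v) (hr : ∀ w, {v | r v w}.Countable)
    (I : Set W → Prop) (mono : ∀ s t, s ⊆ t → I t → I s)
    (union : ∀ s : ℕ → Set W, (∀ n, I (s n)) → I (⋃ n, s n))
    (count : ∀ s : Set W, s.Countable → I s)
    (ccc : ∀ s : W → Set W, Pairwise (Function.onFun Disjoint s) → {w | ¬ I (s w)}.Countable) :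
    I Set.univ := by
  have he : ∀ w, ∃ e : W → ℕ, Set.InjOn e {v | r v w} := fun w =>
    Set.countable_iff_exists_injOn.1 (hr w)
  choose e he using he
  let A : ℕ → W → Set W := fun n v => {w | r v w ∧ e w v = n}
  have hA : ∀ n, {v | ¬ I (A n v)}.Countable := by
    intro n
    apply ccc
    intro v v' hvv'
    rw [Function.onFun, Set.disjoint_left]
    rintro w ⟨h1, h2⟩ ⟨h3, h4⟩
    exact hvv' (he w h1 h3 (h2.trans h4.symm))
  by_cases hall : ∃ v, ∀ n, I (A n v)
  · obtain ⟨v, hv⟩ := hall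
    have h2 := count ({w | r w v} ∪ {v}) ((hr v).union (Set.countable_singleton v))
    refine mono _ _ ?_ (union (fun n => Nat.casesOn n ({w | r w v} ∪ {v}) (fun k => A k v)) ?_)
    · intro w _
      rw [Set.mem_iUnion]
      rcases htri v w with h | h | h
      · exact ⟨e w v + 1, h, rfl⟩
      · exact ⟨0, Or.inr h.symm⟩
      · exact ⟨0, Or.inl h⟩
    · rintro (_ | k)
      · exact h2
      · exact hv k
  · push Not at hall
    refine count _ ((Set.countable_iUnion hA).mono ?_)
    intro v _
    obtain ⟨n, hn⟩ := hall v
    exact Set.mem_iUnion.2 ⟨n, hn⟩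

/-- A Polish space is empty if it carries a function whose fibres are closed, whose preimages are all
Borel, whose values on every nonempty open set are uncountable, and whose range carries a trichotomous
relation with countable initial segments. -/
theorem isEmpty_of_uncountable_local_range {Z W : Type*} [TopologicalSpace Z] [PolishSpace Z]
    [MeasurableSpace Z] [BorelSpace Z] (g : Z → W)
    (hg : ∀ B : Set W, MeasurableSet (g ⁻¹' B)) (hcl : ∀ w, IsClosed (g ⁻¹' {w}))
    (hbig : ∀ U : Set Z, IsOpen U → U.Nonempty → ¬ (g '' U).Countable)
    (r : W → W → Prop) (htri : ∀ v w, r v w ∨ v = w ∨ r w v) (hr : ∀ w, {v | r v w}.Countable) :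
    IsEmpty Z := by
  by_contra hne
  rw [not_isEmpty_iff] at hne
  have hsing : ∀ w, IsMeagre (g ⁻¹' {w}) := by
    intro w
    apply IsNowhereDense.isMeagre
    rw [(hcl w).isNowhereDense_iff]
    by_contra hI
    refine hbig _ isOpen_interior (Set.nonempty_iff_ne_empty.2 hI) ?_
    refine (Set.countable_singleton w).mono ?_
    rintro _ ⟨x, hx, rfl⟩
    exact (interior_subset : interior (g ⁻¹' {w}) ⊆ _) hx
  have key := ulam_sigmaIdeal r htri hr (fun B => IsMeagre (g ⁻¹' B))
    (fun s t hst ht => ht.mono (Set.preimage_mono hst))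
    (fun s hs => by rw [Set.preimage_iUnion]; exact isMeagre_iUnion hs)
    (fun s hs => by
      rw [← Set.biUnion_preimage_singleton]
      exact isMeagre_biUnion hs fun w _ => hsing w)
    (fun s hs => by
      choose U hU hUeq using fun w => (hg (s w)).residualEq_isOpen
      have hdiff : ∀ w, IsMeagre (g ⁻¹' (s w)) ∨ (U w).Nonempty := by
        intro w
        by_contra! h
        apply h.1
        have := hUeq w
        rw [h.2] at this
        rw [IsMeagre]
        filter_upwards [this] with x hx hxs
        exact (hx.mp hxs).elim
      refine Set.PairwiseDisjoint.countable_of_isOpen (s := U) ?_ (fun w _ => hU w) ?_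
      · intro v _ w _ hvw
        change Disjoint (U v) (U w)
        rw [Set.disjoint_iff_inter_eq_empty]
        by_contra hn
        refine not_isMeagre_of_isOpen ((hU v).inter (hU w)) (Set.nonempty_iff_ne_empty.2 hn) ?_
        rw [IsMeagre]
        filter_upwards [hUeq v, hUeq w] with x hx hx' hxm
        exact Set.disjoint_left.1 (hs hvw) (hx.mpr hxm.1) (hx'.mpr hxm.2)
      · intro w hw
        exact (hdiff w).resolve_left hw)
  exact not_isMeagre_of_isOpen (X := Z) isOpen_univ Set.univ_nonempty key

/-- A map on a Polish space all of whose preimages are Borel and which becomes continuous after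
an injection into `ℝ` has countable range, if its target has a linear order with countable
initial segments. -/
theorem countable_range_of_continuous {X W : Type*} [TopologicalSpace X] [PolishSpace X]
    [MeasurableSpace X] [BorelSpace X] (g : X → W)
    (hg : ∀ B : Set W, MeasurableSet (g ⁻¹' B)) (ι : W → ℝ) (hι : Function.Injective ι)
    (hc : Continuous (ι ∘ g))
    (r : W → W → Prop) (htri : ∀ v w, r v w ∨ v = w ∨ r w v) (hr : ∀ w, {v | r v w}.Countable) :
    (Set.range g).Countable := by
  let 𝒰 : Set (Set X) := {U | IsOpen U ∧ (g '' U).Countable}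
  let O : Set X := ⋃ U ∈ 𝒰, U
  have hO : IsOpen O := isOpen_biUnion fun U hU => hU.1
  have hOc : (g '' O).Countable := by
    obtain ⟨T, hT𝒰, hTc, hTU⟩ :=
      TopologicalSpace.isOpen_biUnion_countable 𝒰 (fun U => U) (fun U hU => hU.1)
    change (g '' (⋃ U ∈ 𝒰, U)).Countable
    rw [← hTU, Set.image_iUnion₂]
    exact hTc.biUnion fun U hU => (hT𝒰 hU).2
  have hZ : IsClosed Oᶜ := hO.isClosed_compl
  have : PolishSpace (Oᶜ : Set X) := hZ.polishSpace
  have hempty : IsEmpty (Oᶜ : Set X) := by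
    refine isEmpty_of_uncountable_local_range (fun x : (Oᶜ : Set X) => g x)
      (fun B => measurable_subtype_coe (hg B)) ?_ ?_ r htri hr
    · intro w
      have : (fun x : (Oᶜ : Set X) => g x) ⁻¹' {w} =
          (fun x : (Oᶜ : Set X) => (ι ∘ g) x) ⁻¹' {ι w} := by
        ext x; simp [hι.eq_iff]
      rw [this]
      exact isClosed_singleton.preimage (hc.comp continuous_subtype_val)
    · rintro U hU ⟨x, hx⟩ hcount
      obtain ⟨V, hV, rfl⟩ := isOpen_induced_iff.1 hU
      refine x.2 (Set.mem_biUnion (x := V) ⟨hV, ?_⟩ hx)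
      refine (hcount.union hOc).mono ?_
      rintro _ ⟨y, hy, rfl⟩
      by_cases hyO : y ∈ O
      · exact Or.inr ⟨y, hyO, rfl⟩
      · exact Or.inl ⟨⟨y, hyO⟩, hy, rfl⟩
  rw [← Set.image_univ]
  refine hOc.mono (Set.image_mono fun x _ => ?_)
  by_contra hx
  exact hempty.elim ⟨x, hx⟩

/-- A map on a Polish space all of whose preimages are Borel has countable range. -/
theorem countable_range_of_forall_measurableSet_preimage {X A : Type*} [tX : TopologicalSpace X]
    [pX : PolishSpace X] [MeasurableSpace X] [bX : BorelSpace X] (g : X → A)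
    (hg : ∀ B : Set A, MeasurableSet (g ⁻¹' B)) : (Set.range g).Countable := by
  classical
  by_contra hunc
  rw [← Cardinal.le_aleph0_iff_set_countable, ← Cardinal.lt_aleph_one_iff, not_lt,
    Cardinal.le_mk_iff_exists_subset] at hunc
  obtain ⟨p, hp, hpc⟩ := hunc
  obtain ⟨r, hwo, hrt⟩ := Cardinal.exists_ord_eq p
  have hr : ∀ w, {v | r v w}.Countable := by
    intro w
    rw [← Cardinal.le_aleph0_iff_set_countable, ← Cardinal.lt_aleph_one_iff, ← hpc]
    have h1 := Ordinal.typein_lt_type r w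
    rw [← hrt, Cardinal.lt_ord] at h1
    exact h1
  have hpinf : ¬ p.Countable := by
    rw [← Cardinal.le_aleph0_iff_set_countable, ← Cardinal.lt_aleph_one_iff, hpc]; exact lt_irrefl _
  have hι : ∃ ι : p → ℝ, Function.Injective ι := by
    have : Cardinal.lift.{0} (Cardinal.mk p) ≤ Cardinal.lift (Cardinal.mk ℝ) := by
      rw [hpc, Cardinal.mk_real]
      simpa using Cardinal.aleph_one_le_continuum
    obtain ⟨e⟩ := Cardinal.lift_mk_le'.1 this
    exact ⟨e, e.injective⟩
  obtain ⟨ι, hι⟩ := hι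
  have hpn : p.Nonempty := by
    by_contra h
    rw [Set.not_nonempty_iff_eq_empty] at h
    exact hpinf (h ▸ Set.countable_empty)
  obtain ⟨a₀, ha₀⟩ := hpn
  let φ : A → p := fun a => if h : a ∈ p then ⟨a, h⟩ else ⟨a₀, ha₀⟩
  have hgφ : ∀ B : Set p, MeasurableSet ((φ ∘ g) ⁻¹' B) := fun B => hg (φ ⁻¹' B)
  have hmeas : Measurable (ι ∘ φ ∘ g) := fun B _ => hgφ (ι ⁻¹' B)
  obtain ⟨t', ht', hcont, hpol⟩ := hmeas.exists_continuous
  have hborel : @BorelSpace X t' _ := by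
    refine @BorelSpace.mk _ t' _ ?_
    rw [borel_eq_borel_of_le hpol pX ht']
    exact bX.measurable_eq
  have hcount := @countable_range_of_continuous X p t' hpol _ hborel (φ ∘ g) hgφ ι hι hcont r
    (fun v w => trichotomous_of r v w) hr
  refine hpinf ((hcount.image Subtype.val).mono fun a ha => ?_)
  obtain ⟨x, rfl⟩ := hp ha
  refine ⟨φ (g x), ⟨x, rfl⟩, ?_⟩
  simp [φ, ha]

/-- On a compact subset of a metric space, a map all of whose preimages are Borel takes only
countably many values. -/
theorem IsCompact.countable_image_of_forall_measurableSet_preimage {M A : Type*} [MetricSpace M]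
    [MeasurableSpace M] [BorelSpace M] {K : Set M} (hK : IsCompact K) (g : M → A)
    (hg : ∀ B : Set A, MeasurableSet (g ⁻¹' B)) : (g '' K).Countable := by
  have : CompactSpace K := isCompact_iff_compactSpace.1 hK
  have h := countable_range_of_forall_measurableSet_preimage (fun x : K => g x)
    (fun B => measurable_subtype_coe (hg B))
  refine h.mono ?_
  rintro _ ⟨x, hx, rfl⟩
  exact ⟨⟨x, hx⟩, rfl⟩

/-- A locally compact metric space has a Borel partition, all unions of which are Borel, into sets
with compact closure. -/
theorem exists_partition_measurable_compact (M : Type*) [MetricSpace M] [LocallyCompactSpace M]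
    [MeasurableSpace M] [BorelSpace M] :
    ∃ (q : M → M) (K : M → Set M), (∀ B : Set M, MeasurableSet (q ⁻¹' B)) ∧
      (∀ a, IsCompact (K a)) ∧ ∀ y, y ∈ K (q y) := by
  choose K hK hKn using fun x : M => exists_compact_mem_nhds x
  let U : M → Set M := fun x => interior (K x)
  have hU : ∀ x, x ∈ U x := fun x => mem_interior_iff_mem_nhds.2 (hKn x)
  have hwf : WellFounded (WellOrderingRel (α := M)) := IsWellFounded.wf
  have hne : ∀ y : M, {x | y ∈ U x}.Nonempty := fun y => ⟨y, hU y⟩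
  let q : M → M := fun y => hwf.min {x | y ∈ U x} (hne y)
  have hqU : ∀ y, y ∈ U (q y) := fun y => hwf.min_mem {x | y ∈ U x} (hne y)
  have hqmin : ∀ y x, WellOrderingRel x (q y) → y ∉ U x := fun y x hx hy =>
    hwf.not_lt_min {x | y ∈ U x} hy hx
  have hquniq : ∀ y x, y ∈ U x → (∀ x', WellOrderingRel x' x → y ∉ U x') → q y = x := by
    intro y x hy hx
    rcases trichotomous_of WellOrderingRel (q y) x with h | h | h
    · exact (hx _ h (hqU y)).elim
    · exact h
    · exact (hqmin y x h hy).elim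
  let E : ℕ → M → Set M := fun n x =>
    {y | ((n : ENNReal) + 1)⁻¹ ≤ Metric.infEDist y (U x)ᶜ} ∩
      {y | ∀ x', WellOrderingRel x' x → y ∉ U x'}
  have hEcl : ∀ n x, IsClosed (E n x) := by
    intro n x
    refine (isClosed_le continuous_const Metric.continuous_infEDist).inter ?_
    have : {y | ∀ x', WellOrderingRel x' x → y ∉ U x'} =
        ⋂ x', ⋂ (_ : WellOrderingRel x' x), (U x')ᶜ := by
      ext y; simp
    rw [this]
    exact isClosed_iInter fun x' => isClosed_iInter fun _ => isOpen_interior.isClosed_compl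
  have hpos : ∀ n : ℕ, 0 < ((n : ENNReal) + 1)⁻¹ := fun n =>
    ENNReal.inv_pos.2 (by finiteness)
  have hEU : ∀ n x y, y ∈ E n x → y ∈ U x := by
    intro n x y hy
    by_contra hyU
    have h0 : Metric.infEDist y (U x)ᶜ = 0 := Metric.infEDist_zero_of_mem hyU
    have := hy.1
    rw [Set.mem_ofPred_eq, h0] at this
    exact (hpos n).not_ge this
  have hsep : ∀ n x x' z z', WellOrderingRel x x' → z ∈ E n x → z' ∈ E n x' →
      ((n : ENNReal) + 1)⁻¹ ≤ edist z z' := by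
    intro n x x' z z' hxx' hz hz'
    exact hz.1.trans (Metric.infEDist_le_edist_of_mem (hz'.2 x hxx'))
  have hEmeas : ∀ (B : Set M) n, IsClosed (⋃ x : B, E n x) := by
    intro B n
    refine LocallyFinite.isClosed_iUnion ?_ fun x => hEcl n x
    intro y
    refine ⟨Metric.eball y (((n : ENNReal) + 1)⁻¹ / 2),
      Metric.eball_mem_nhds y (ENNReal.div_pos (hpos n).ne' (by simp)), ?_⟩
    apply Set.Subsingleton.finite
    have hlt : ∀ z z', z ∈ Metric.eball y (((n : ENNReal) + 1)⁻¹ / 2) →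
        z' ∈ Metric.eball y (((n : ENNReal) + 1)⁻¹ / 2) → edist z z' < ((n : ENNReal) + 1)⁻¹ := by
      intro z z' hz hz'
      calc edist z z' ≤ edist z y + edist z' y := edist_triangle_right _ _ _
        _ < ((n : ENNReal) + 1)⁻¹ / 2 + ((n : ENNReal) + 1)⁻¹ / 2 := ENNReal.add_lt_add hz hz'
        _ = _ := ENNReal.add_halves _
    rintro ⟨x, hx⟩ ⟨z, hzE, hz⟩ ⟨x', hx'⟩ ⟨z', hzE', hz'⟩
    rw [Subtype.mk_eq_mk]
    rcases trichotomous_of WellOrderingRel x x' with h | h | h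
    · exact ((hsep n x x' z z' h hzE hzE').not_gt (hlt z z' hz hz')).elim
    · exact h
    · exact ((hsep n x' x z' z h hzE' hzE).not_gt (hlt z' z hz' hz)).elim
  refine ⟨q, K, fun B => ?_, hK, fun y => interior_subset (hqU y)⟩
  have hqB : q ⁻¹' B = ⋃ n : ℕ, ⋃ x : B, E n x := by
    ext y
    simp only [Set.mem_preimage, Set.mem_iUnion]
    constructor
    · intro hy
      have h0 : 0 < Metric.infEDist y (U (q y))ᶜ := by
        rw [Metric.infEDist_pos_iff_notMem_closure, isOpen_interior.isClosed_compl.closure_eq]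
        exact fun h => h (hqU y)
      obtain ⟨n, hn⟩ := ENNReal.exists_inv_nat_lt h0.ne'
      refine ⟨n, ⟨q y, hy⟩, ?_, fun x' hx' => hqmin y x' hx'⟩
      exact (ENNReal.inv_le_inv.2 le_self_add).trans hn.le
    · rintro ⟨n, ⟨x, hx⟩, hy⟩
      rw [hquniq y x (hEU n x y hy) hy.2]
      exact hx
  rw [hqB]
  exact MeasurableSet.iUnion fun n => (hEmeas B n).measurableSet

/-- In a well-founded relation with countable sets of predecessors every rank is below `ω₁`. -/
theorem rank_lt_omega_one_of_countable {A : Type*} (r : A → A → Prop) [IsWellFounded A r]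
    (hr : ∀ b, {x | r x b}.Countable) (a : A) : IsWellFounded.rank r a < Ordinal.omega 1 := by
  induction a using IsWellFounded.induction r with
  | _ a ih =>
    rw [IsWellFounded.rank_eq]
    have : Countable {b // r b a} := (hr a).to_subtype
    refine Ordinal.iSup_lt_omega_one fun b => ?_
    exact (Cardinal.isSuccLimit_omega 1).succ_lt (ih b b.2)

/-- For a transitive reflexive relation with countable sets of successors and a totally defined
nonzero finite measure, there is a set of positive measure no two points of which are related. -/
theorem exists_antichain_pos {Ω A : Type*} [MeasurableSpace Ω] (ν : Measure Ω) [IsFiniteMeasure ν]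
    (hν : ν ≠ 0) (q : Ω → A) (hq : ∀ B : Set A, MeasurableSet (q ⁻¹' B))
    (O : A → Set A) (hO : ∀ a, (O a).Countable) (hrefl : ∀ a, a ∈ O a)
    (htrans : ∀ a b, b ∈ O a → O b ⊆ O a) :
    ∃ S : Set A, ν (q ⁻¹' S) ≠ 0 ∧ ∀ a ∈ S, ∀ b ∈ S, b ∈ O a → b = a := by
  by_contra! hno
  have hwf : WellFounded (WellOrderingRel (α := A)) := IsWellFounded.wf
  have hne : ∀ x : A, {s | x ∈ O s}.Nonempty := fun x => ⟨x, hrefl x⟩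
  let step : A → A := fun x => hwf.min {s | x ∈ O s} (hne x)
  have hstep : ∀ x, x ∈ O (step x) := fun x => hwf.min_mem {s | x ∈ O s} (hne x)
  have hmin : ∀ x s, x ∈ O s → ¬ WellOrderingRel s (step x) := fun x s hx =>
    hwf.not_lt_min {s | x ∈ O s} hx
  choose e he using fun s => Set.countable_iff_exists_injOn.1 (hO s)
  obtain ⟨n, hn⟩ : ∃ n : ℕ, ν (q ⁻¹' {x | e (step x) x = n}) ≠ 0 := by
    by_contra! h
    apply hν
    rw [← Measure.measure_univ_eq_zero]
    refine measure_mono_null ?_ (measure_iUnion_null h)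
    intro y _
    exact Set.mem_iUnion.2 ⟨_, rfl⟩
  set T : Set A := {x | e (step x) x = n} with hT
  let r : A → A → Prop := fun x b => x ∈ O b ∧ x ≠ b ∧ x ∈ T ∧ b ∈ T
  have hrstep : ∀ x b, r x b → WellOrderingRel (step x) (step b) := by
    rintro x b ⟨hxb, hne, hxT, hbT⟩
    have hx : x ∈ O (step b) := htrans _ _ (hstep b) hxb
    rcases trichotomous_of WellOrderingRel (step x) (step b) with h | h | h
    · exact h
    · refine (hne (he (step b) hx (hstep b) ?_)).elim
      rw [hT, Set.mem_ofPred_eq] at hxT hbT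
      rw [hbT, ← h, hxT]
    · exact (hmin x _ hx h).elim
  have : IsWellFounded A r :=
    ⟨Subrelation.wf (fun {x b} h => hrstep x b h) (InvImage.wf step hwf)⟩
  have hlt := rank_lt_omega_one_of_countable r
    (fun b => (hO b).mono fun x hx => hx.1)
  let c : A → Set.Iio (Ordinal.omega 1) := fun a => ⟨IsWellFounded.rank r a, hlt a⟩
  have hsing : ∀ w, ν (q ⁻¹' (T ∩ c ⁻¹' {w})) = 0 := by
    intro w
    by_contra hpos
    obtain ⟨a, ha, b, hb, hba, hne⟩ := hno _ hpos
    have h1 := IsWellFounded.rank_lt_of_rel (show r b a from ⟨hba, hne, hb.1, ha.1⟩)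
    have h2 : c b = c a := hb.2.trans ha.2.symm
    exact h1.ne (congrArg Subtype.val h2)
  have key := ulam_sigmaIdeal (W := Set.Iio (Ordinal.omega 1)) (· < ·) lt_trichotomy
    (fun w => by
      have h : (Set.Iio (w : Ordinal)).Countable := by
        rw [← Cardinal.le_aleph0_iff_set_countable, Cardinal.mk_Iio_ordinal,
          Cardinal.lift_le_aleph0, ← Cardinal.lt_aleph_one_iff]
        exact Cardinal.lt_omega_iff_card_lt.1 w.2
      exact h.preimage_of_injOn Subtype.val_injective.injOn)
    (fun B => ν (q ⁻¹' (T ∩ c ⁻¹' B)) = 0)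
    (fun s t hst ht => measure_mono_null
      (Set.preimage_mono (Set.inter_subset_inter_right _ (Set.preimage_mono hst))) ht)
    (fun s hs => by
      rw [Set.preimage_iUnion, Set.inter_iUnion, Set.preimage_iUnion]
      exact measure_iUnion_null hs)
    (fun s hs => by
      have hs' : T ∩ c ⁻¹' s = ⋃ w ∈ s, T ∩ c ⁻¹' {w} := by
        rw [← Set.inter_iUnion₂, Set.biUnion_preimage_singleton]
      rw [hs', Set.preimage_iUnion₂]
      exact (measure_biUnion_null_iff hs).2 fun w _ => hsing w)
    (fun s hs => by
      have := Measure.countable_meas_pos_of_disjoint_iUnion (μ := ν)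
        (As := fun w => q ⁻¹' (T ∩ c ⁻¹' (s w))) (fun w => hq _)
        (fun v w hvw => ((hs hvw).preimage c).mono Set.inter_subset_right
          Set.inter_subset_right |>.preimage q)
      simpa only [pos_iff_ne_zero] using this)
  rw [Set.preimage_univ, Set.inter_univ] at key
  exact hn key

/-- If every forward invariant set has measure `0` or `1`, then a uniformly equicontinuous countable
family of functions on a locally compact metric space is, almost everywhere, uniformly
approximated by its values along a sequence, even if the measure is not separable. -/
theorem exists_seq_ae_forall_abs_sub_le {M ι : Type*} [MetricSpace M] [LocallyCompactSpace M]
    [MeasurableSpace M] [BorelSpace M] [Countable ι] (ν : Measure M) [IsProbabilityMeasure ν]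
    {f : M → M} (hf : Measurable f)
    (hinv : ∀ B, MeasurableSet B → B ⊆ f ⁻¹' B → ν B = 0 ∨ ν B = 1) (Φ : M → ι → ℝ)
    (hΦ : ∀ ε > 0, ∃ δ > 0, ∀ y y', dist y y' < δ → ∀ u, |Φ y u - Φ y' u| ≤ ε) :
    ∃ s : ℕ → M, ∀ ε > 0, ∀ᵐ y ∂ν, ∃ k, ∀ u, |Φ y u - Φ (s k) u| ≤ ε := by
  obtain ⟨q, K, hq, hK, hyK⟩ := exists_partition_measurable_compact M
  have : Nonempty M := ν.nonempty_of_neZero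
  let N : M → Set M := fun a => (q ∘ f) '' K a
  have hN : ∀ a, (N a).Countable := fun a =>
    (hK a).countable_image_of_forall_measurableSet_preimage (q ∘ f) fun B => hf (hq B)
  let O : M → Set M := fun a => {b | Relation.ReflTransGen (fun a b => b ∈ N a) a b}
  have hrefl : ∀ a, a ∈ O a := fun a => Relation.ReflTransGen.refl
  have htrans : ∀ a b, b ∈ O a → O b ⊆ O a := fun a b hb c hc => Relation.ReflTransGen.trans hb hc
  have hstep : ∀ a y, q y ∈ O a → q (f y) ∈ O a := fun a y hy =>
    Relation.ReflTransGen.tail hy ⟨y, hyK y, rfl⟩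
  have hO : ∀ a, (O a).Countable := by
    intro a
    let R : ℕ → Set M := fun n => Nat.rec {a} (fun _ s => ⋃ b ∈ s, N b) n
    have hR : ∀ n, (R n).Countable := by
      intro n
      induction n with
      | zero => exact Set.countable_singleton a
      | succ n ih => exact ih.biUnion fun b _ => hN b
    refine (Set.countable_iUnion hR).mono ?_
    intro b hb
    induction hb with
    | refl => exact Set.mem_iUnion.2 ⟨0, rfl⟩
    | tail _ hbc ih =>
      obtain ⟨n, hn⟩ := Set.mem_iUnion.1 ih
      exact Set.mem_iUnion.2 ⟨n + 1, Set.mem_biUnion hn hbc⟩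
  obtain ⟨S, hS, hfree⟩ := exists_antichain_pos ν (NeZero.ne ν) q hq O hO hrefl htrans
  have hzo : ∀ S' : Set M, ν (q ⁻¹' ⋃ a ∈ S', O a) = 0 ∨ ν (q ⁻¹' ⋃ a ∈ S', O a) = 1 := by
    intro S'
    refine hinv _ (hq _) ?_
    intro y hy
    simp only [Set.mem_preimage, Set.mem_iUnion, exists_prop] at hy ⊢
    obtain ⟨a, ha, hya⟩ := hy
    exact ⟨a, ha, hstep a y hya⟩
  have hsepV : ∀ a, ∃ s : ℕ → M, (⋃ b ∈ O a, K b) ⊆ closure (Set.range s) := by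
    intro a
    have : Countable (O a) := (hO a).to_subtype
    obtain ⟨c, hc, hcl⟩ : TopologicalSpace.IsSeparable (⋃ b ∈ O a, K b) := by
      rw [Set.biUnion_eq_iUnion]
      exact TopologicalSpace.IsSeparable.iUnion fun b => (hK b).isSeparable
    obtain ⟨s, hs⟩ := (hc.insert (Classical.arbitrary M)).exists_eq_range ⟨_, Set.mem_insert _ _⟩
    exact ⟨s, hcl.trans (closure_mono (hs ▸ Set.subset_insert _ _))⟩
  choose s hs using hsepV
  let code : M → ℕ → ι → ℝ := fun a k u => Φ (s a k) u
  have hconst : ∃ r, (fun y => code (q y)) =ᵐ[ν.restrict (q ⁻¹' S)] Function.const M r := by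
    refine Filter.exists_eventuallyEq_const_of_forall_separating MeasurableSet fun U _ => ?_
    rw [ae_restrict_iff' (hq S), ae_restrict_iff' (hq S)]
    let S' : Set M := S ∩ code ⁻¹' U
    rcases hzo S' with h | h
    · right
      have h2 : ∀ᵐ y ∂ν, y ∉ q ⁻¹' ⋃ a ∈ S', O a := measure_eq_zero_iff_ae_notMem.1 h
      filter_upwards [h2] with y hy hyS hyU
      exact hy (Set.mem_biUnion (x := q y) ⟨hyS, hyU⟩ (hrefl _))
    · left
      have h2 : ∀ᵐ y ∂ν, y ∈ q ⁻¹' ⋃ a ∈ S', O a := (mem_ae_iff_prob_eq_one (hq _)).2 h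
      filter_upwards [h2] with y hy hyS
      simp only [Set.mem_preimage, Set.mem_iUnion, exists_prop] at hy
      obtain ⟨a, ha, hya⟩ := hy
      have := hfree a ha.1 (q y) hyS hya
      rw [this]
      exact ha.2
  obtain ⟨r, hr⟩ := hconst
  let S₁ : Set M := S ∩ code ⁻¹' {r}
  have hS₁ : ν (q ⁻¹' S₁) ≠ 0 := by
    intro h0
    apply hS
    rw [Filter.EventuallyEq, ae_restrict_iff' (hq S)] at hr
    rw [measure_eq_zero_iff_ae_notMem]
    filter_upwards [hr, measure_eq_zero_iff_ae_notMem.1 h0] with y h1 h2 hyS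
    exact h2 ⟨hyS, h1 hyS⟩
  obtain ⟨y₁, hy₁⟩ := nonempty_of_measure_ne_zero hS₁
  refine ⟨s (q y₁), fun ε hε => ?_⟩
  obtain ⟨δ, hδ, hδΦ⟩ := hΦ ε hε
  have hfull : ν (q ⁻¹' ⋃ a ∈ S₁, O a) = 1 := by
    refine (hzo S₁).resolve_left fun h => hS₁ (measure_mono_null ?_ h)
    exact Set.preimage_mono fun a ha => Set.mem_biUnion ha (hrefl a)
  filter_upwards [(mem_ae_iff_prob_eq_one (hq _)).2 hfull] with y hy
  simp only [Set.mem_preimage, Set.mem_iUnion, exists_prop] at hy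
  obtain ⟨a, ha, hya⟩ := hy
  have hyV : y ∈ closure (Set.range (s a)) := hs a (Set.mem_biUnion hya (hyK y))
  obtain ⟨_, ⟨k, rfl⟩, hk⟩ := Metric.mem_closure_iff.1 hyV δ hδ
  refine ⟨k, fun u => ?_⟩
  have hcode : code a = code (q y₁) := ha.2.trans hy₁.2.symm
  have : Φ (s (q y₁) k) u = Φ (s a k) u := (congrFun (congrFun hcode k) u).symm
  rw [this]
  exact hδΦ _ _ hk u

/-- The lattice point `z₀ + ⌊ℓ z⌋`. -/
noncomputable def latticePt {d : ℕ} (z₀ : Fin d → ℤ) (ℓ : ℝ) (z : Fin d → ℝ) : Fin d → ℤ :=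
  z₀ + fun i => ⌊z i * ℓ⌋

theorem measurable_latticePt {d : ℕ} (z₀ : Fin d → ℤ) (ℓ : ℝ) : Measurable (latticePt z₀ ℓ) := by
  unfold latticePt
  refine measurable_const.add (measurable_pi_lambda _ fun i => ?_)
  exact Int.measurable_floor.comp ((measurable_pi_apply (X := fun _ => ℝ) i).mul_const ℓ)

theorem pow_mul_volume_real_inter_latticePt_le {d : ℕ} (z₀ : Fin d → ℤ) {ℓ : ℝ} (hℓ : 0 < ℓ)
    (B : Set (Fin d → ℝ)) (w : Fin d → ℤ) :
    ℓ ^ d * volume.real (B ∩ latticePt z₀ ℓ ⁻¹' {w}) ≤ 1 := by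
  have hsub : B ∩ latticePt z₀ ℓ ⁻¹' {w} ⊆
      Set.Icc (fun i => ((w i : ℝ) - z₀ i) / ℓ) (fun i => ((w i : ℝ) - z₀ i + 1) / ℓ) := by
    rintro z ⟨-, hz⟩
    have hz' : ∀ i, (w i : ℝ) - z₀ i = ⌊z i * ℓ⌋ := by
      intro i
      have := congrFun hz i
      simp only [latticePt, Pi.add_apply] at this
      rw [← this]; push_cast; ring
    refine ⟨fun i => ?_, fun i => ?_⟩
    · change _ / ℓ ≤ _
      rw [hz' i, div_le_iff₀ hℓ]
      exact Int.floor_le _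
    · change _ ≤ _ / ℓ
      rw [hz' i, le_div_iff₀ hℓ]
      exact (Int.lt_floor_add_one _).le
  have hvol : volume.real (Set.Icc (fun i => ((w i : ℝ) - z₀ i) / ℓ)
      (fun i => ((w i : ℝ) - z₀ i + 1) / ℓ)) = (ℓ ^ d)⁻¹ := by
    rw [Measure.real, Real.volume_Icc_pi_toReal]
    · have : ∀ i, ((w i : ℝ) - z₀ i + 1) / ℓ - ((w i : ℝ) - z₀ i) / ℓ = ℓ⁻¹ := by
        intro i; field_simp; ring
      simp [this]
    · intro i
      change _ / ℓ ≤ _ / ℓ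
      gcongr; linarith
  have hle := measureReal_mono hsub (μ := volume) (by
    exact isCompact_Icc.measure_lt_top.ne)
  rw [hvol] at hle
  calc _ ≤ ℓ ^ d * (ℓ ^ d)⁻¹ := by gcongr
    _ = 1 := mul_inv_cancel₀ (by positivity)

section LocalDensity

variable {d : ℕ} {M : Type*} [MeasurableSpace M]

/-- The rescaled local density of `t` at the lattice point `z₀ + ⌊ℓ z⌋`, weighted by `h`. -/
noncomputable def localDensity (ν : Measure M) (t : M → Fin d → ℤ) (z₀ : Fin d → ℤ) (ℓ : ℝ) (h : M → ℝ)
    (z : Fin d → ℝ) : ℝ :=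
  ℓ ^ d * ∫ y, (if t y = latticePt z₀ ℓ z then h y else 0) ∂ν

theorem setIntegral_mul_localDensity (ν : Measure M) [IsProbabilityMeasure ν] {t : M → Fin d → ℤ}
    (ht : Measurable t) (z₀ : Fin d → ℤ) (ℓ : ℝ) {h : M → ℝ} (hh : Measurable h) {C : ℝ}
    (hC : ∀ y, |h y| ≤ C) {c : (Fin d → ℤ) → ℝ} (hc : ∀ u, |c u| ≤ 1) {B : Set (Fin d → ℝ)}
    (hBfin : volume B ≠ ⊤) :
    IntegrableOn (fun z => c (latticePt z₀ ℓ z) * localDensity ν t z₀ ℓ h z) B ∧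
    ∫ z in B, c (latticePt z₀ ℓ z) * localDensity ν t z₀ ℓ h z =
      ∫ y, h y * c (t y) * (ℓ ^ d * volume.real (B ∩ latticePt z₀ ℓ ⁻¹' {t y})) ∂ν := by
  have : IsFiniteMeasure (volume.restrict B) := ⟨by simpa using hBfin.lt_top⟩
  let F : M → (Fin d → ℝ) → ℝ := fun y z =>
    if t y = latticePt z₀ ℓ z then ℓ ^ d * (h y * c (t y)) else 0
  have hset : MeasurableSet {x : M × (Fin d → ℝ) | t x.1 = latticePt z₀ ℓ x.2} :=
    measurableSet_eq_fun (ht.comp measurable_fst) ((measurable_latticePt z₀ ℓ).comp measurable_snd)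
  have hFm : Measurable (Function.uncurry F) := by
    refine Measurable.ite hset ?_ measurable_const
    exact measurable_const.mul ((hh.comp measurable_fst).mul
      ((Measurable.of_discrete (f := c)).comp (ht.comp measurable_fst)))
  have hF : Integrable (Function.uncurry F) (ν.prod (volume.restrict B)) := by
    refine Integrable.of_bound hFm.aestronglyMeasurable (|ℓ ^ d| * (C * 1)) (ae_of_all _ ?_)
    rintro ⟨y, z⟩
    have hC0 : 0 ≤ C := (abs_nonneg _).trans (hC y)
    simp only [Function.uncurry, F]
    split_ifs
    · rw [Real.norm_eq_abs, abs_mul, abs_mul]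
      gcongr
      exacts [hC y, hc _]
    · rw [norm_zero]; positivity
  have h1 : ∀ z, ∫ y, F y z ∂ν = c (latticePt z₀ ℓ z) * localDensity ν t z₀ ℓ h z := by
    intro z
    rw [localDensity, ← integral_const_mul, ← integral_const_mul]
    congr 1 with y
    simp only [F]
    split_ifs with hy
    · rw [hy]; ring
    · simp
  have h2 : ∀ y, ∫ z in B, F y z =
      h y * c (t y) * (ℓ ^ d * volume.real (B ∩ latticePt z₀ ℓ ⁻¹' {t y})) := by
    intro y
    have : F y = (latticePt z₀ ℓ ⁻¹' {t y}).indicator fun _ => ℓ ^ d * (h y * c (t y)) := by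
      ext z
      simp only [F, Set.indicator, Set.mem_preimage, Set.mem_singleton_iff]
      exact if_congr eq_comm rfl rfl
    rw [this, setIntegral_indicator (measurable_latticePt z₀ ℓ (measurableSet_singleton _)),
      setIntegral_const, smul_eq_mul]
    ring
  constructor
  · have := hF.integral_prod_right
    refine this.congr (ae_of_all _ fun z => ?_)
    exact h1 z
  · simp only [← h1, ← h2]
    exact (integral_integral_swap hF).symm

/-- The law of `t` weighted by `h` is recovered, up to the mass lost, from the local densities on
a bounded set. -/
theorem abs_integral_sub_setIntegral_localDensity_le (ν : Measure M) [IsProbabilityMeasure ν]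
    {t : M → Fin d → ℤ} (ht : Measurable t) (z₀ : Fin d → ℤ) {ℓ : ℝ} (hℓ : 0 < ℓ) {h : M → ℝ}
    (hh : Measurable h) {C : ℝ} (hC : ∀ y, |h y| ≤ C) {c : (Fin d → ℤ) → ℝ} (hc : ∀ u, |c u| ≤ 1)
    {B : Set (Fin d → ℝ)} (hBfin : volume B ≠ ⊤) :
    |∫ y, h y * c (t y) ∂ν - ∫ z in B, c (latticePt z₀ ℓ z) * localDensity ν t z₀ ℓ h z| ≤
      C * (1 - ∫ z in B, localDensity ν t z₀ ℓ (fun _ => 1) z) := by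
  let w : M → ℝ := fun y => ℓ ^ d * volume.real (B ∩ latticePt z₀ ℓ ⁻¹' {t y})
  have hw0 : ∀ y, 0 ≤ w y := fun y => by positivity
  have hw1 : ∀ y, w y ≤ 1 := fun y => pow_mul_volume_real_inter_latticePt_le z₀ hℓ B (t y)
  have hwm : Measurable w :=
    (Measurable.of_discrete
      (f := fun u => ℓ ^ d * volume.real (B ∩ latticePt z₀ ℓ ⁻¹' {u}))).comp ht
  have hwi : Integrable w ν := Integrable.of_bound hwm.aestronglyMeasurable 1
    (ae_of_all _ fun y => by rw [Real.norm_eq_abs, abs_of_nonneg (hw0 y)]; exact hw1 y)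
  have hcm : Measurable fun y => c (t y) := (Measurable.of_discrete (f := c)).comp ht
  have hhc : ∀ y, |h y * c (t y)| ≤ C := fun y => by
    rw [abs_mul]
    calc |h y| * |c (t y)| ≤ C * 1 := by
          gcongr
          exacts [(abs_nonneg _).trans (hC y), hC y, hc _]
      _ = C := mul_one C
  have hhi : Integrable (fun y => h y * c (t y)) ν :=
    Integrable.of_bound (hh.mul hcm).aestronglyMeasurable C (ae_of_all _ hhc)
  have hhwi : Integrable (fun y => h y * c (t y) * w y) ν := by
    refine Integrable.of_bound ((hh.mul hcm).mul hwm).aestronglyMeasurable (C * 1)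
      (ae_of_all _ fun y => ?_)
    rw [Real.norm_eq_abs, abs_mul, abs_of_nonneg (hw0 y)]
    gcongr
    exacts [(abs_nonneg _).trans (hC y), hhc y, hw1 y]
  have e1 : ∫ z in B, localDensity ν t z₀ ℓ (fun _ => 1) z = ∫ y, w y ∂ν := by
    have := (setIntegral_mul_localDensity ν ht z₀ ℓ (h := fun _ => 1) measurable_const (C := 1)
      (by simp) (c := fun _ => 1) (by simp) hBfin).2
    simpa using this
  rw [(setIntegral_mul_localDensity ν ht z₀ ℓ hh hC hc hBfin).2, e1, ← integral_sub hhi hhwi]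
  have e2 : C * (1 - ∫ y, w y ∂ν) = ∫ y, C * (1 - w y) ∂ν := by
    rw [integral_const_mul C fun y => 1 - w y, integral_sub (integrable_const _) hwi]; simp
  rw [e2]
  refine (abs_integral_le_integral_abs).trans (integral_mono (hhi.sub hhwi).abs
    (((integrable_const _).sub hwi).const_mul C) fun y => ?_)
  have : h y * c (t y) - h y * c (t y) * w y = h y * c (t y) * (1 - w y) := by ring
  simp only [this]
  rw [abs_mul, abs_of_nonneg (sub_nonneg.2 (hw1 y))]
  exact mul_le_mul_of_nonneg_right (hhc y) (sub_nonneg.2 (hw1 y))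

end LocalDensity

theorem exists_nat_setIntegral_Icc_ge {d : ℕ} {p : (Fin d → ℝ) → ℝ} (hp : Integrable p)
    (hp1 : ∫ z, p z = 1) {η : ℝ} (hη : 0 < η) :
    ∃ k : ℕ, 1 - η ≤ ∫ z in Set.Icc (fun _ : Fin d => -(k : ℝ)) (fun _ => (k : ℝ)), p z := by
  have hU : (⋃ k : ℕ, Set.Icc (fun _ : Fin d => -(k : ℝ)) (fun _ => (k : ℝ))) = Set.univ := by
    refine Set.eq_univ_of_forall fun z => ?_
    obtain ⟨k, hk⟩ := exists_nat_ge ‖z‖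
    refine Set.mem_iUnion.2 ⟨k, fun i => ?_, fun i => ?_⟩
    · exact (abs_le.1 ((norm_le_pi_norm z i).trans hk)).1
    · exact (abs_le.1 ((norm_le_pi_norm z i).trans hk)).2
  have h := tendsto_setIntegral_of_monotone (μ := volume) (f := p)
    (s := fun k : ℕ => Set.Icc (fun _ : Fin d => -(k : ℝ)) (fun _ => (k : ℝ)))
    (fun k => measurableSet_Icc) (fun k l hkl => Set.Icc_subset_Icc
      (fun i => neg_le_neg (Nat.cast_le.2 hkl)) (fun i => Nat.cast_le.2 hkl))
    (by rw [hU]; exact hp.integrableOn)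
  rw [hU, setIntegral_univ, hp1] at h
  obtain ⟨k, hk⟩ := (h.eventually_const_le (show 1 - η < 1 by linarith)).exists
  exact ⟨k, hk⟩

/-- The shifted mixing local limit theorem implies convergence of the joint law of
`(y, f^n y, τ_n y)` in total variation with respect to the last coordinate, for continuous
observables. -/
theorem ShiftedMLLT.exists_forall_continuous {d : ℕ} {M : Type*} [TopologicalSpace M]
    [MeasurableSpace M] [BorelSpace M] {ν : Measure M} [IsProbabilityMeasure ν]
    {f : M → M} (hf : Measurable f) {τ : M → Fin d → ℤ} (hτ : Measurable τ)
    {L : ℕ → ℝ} {p : (Fin d → ℝ) → ℝ} (hMLLT : ShiftedMLLT ν f τ L p) :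
    ∃ z₀ : ℕ → Fin d → ℤ, ∀ φ₁ φ₂ : M → ℝ, Continuous φ₁ → Continuous φ₂ →
      (∃ C, ∀ y, |φ₁ y| ≤ C) → (∃ C, ∀ y, |φ₂ y| ≤ C) → ∀ ε > 0, ∀ᶠ n in atTop,
        ∀ c : (Fin d → ℤ) → ℝ, (∀ u, |c u| ≤ 1) →
          |∫ y, φ₁ y * φ₂ (f^[n] y) * c (tauSum f τ n y) ∂ν -
            (∫ y, φ₁ y ∂ν) * (∫ y, φ₂ y ∂ν) * ∫ z, c (latticePt (z₀ n) (L n) z) * p z| ≤ ε := by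
  obtain ⟨hL, hpc, hp0, hp1, D, hD⟩ := hMLLT
  have hpi : Integrable p := integrable_of_integral_eq_one hp1
  have htau : ∀ n, Measurable (tauSum f τ n) := fun n =>
    Finset.measurable_fun_sum _ fun j _ => hτ.comp (hf.iterate j)
  have hz₀ : Tendsto (fun n => fun i => ((⌊D n i⌋ : ℝ) - D n i) / L n) atTop
      (𝓝 (0 : Fin d → ℝ)) := by
    rw [tendsto_pi_nhds]
    intro i
    refine squeeze_zero_norm' (a := fun n => (L n)⁻¹) ?_ (tendsto_inv_atTop_zero.comp hL)
    filter_upwards [hL.eventually_gt_atTop 0] with n hn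
    rw [Real.norm_eq_abs, abs_div, abs_of_pos hn, div_eq_mul_inv]
    refine mul_le_of_le_one_left (inv_nonneg.2 hn.le) ?_
    rw [abs_sub_comm, abs_of_nonneg (sub_nonneg.2 (Int.floor_le _))]
    exact (sub_lt_iff_lt_add'.2 (Int.lt_floor_add_one _)).le
  refine ⟨fun n i => ⌊D n i⌋, ?_⟩
  rintro φ₁ φ₂ h₁ h₂ ⟨C₁, hC₁⟩ ⟨C₂, hC₂⟩ ε hε
  have : Nonempty M := ν.nonempty_of_neZero
  have hC₁0 : 0 ≤ C₁ := (abs_nonneg _).trans (hC₁ (Classical.arbitrary M))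
  have hC₂0 : 0 ≤ C₂ := (abs_nonneg _).trans (hC₂ (Classical.arbitrary M))
  set m := (∫ y, φ₁ y ∂ν) * (∫ y, φ₂ y ∂ν) with hm
  set C := C₁ * C₂ with hC
  have hC0 : 0 ≤ C := mul_nonneg hC₁0 hC₂0
  obtain ⟨k, hk⟩ := exists_nat_setIntegral_Icc_ge hpi hp1
    (η := ε / (2 * (C + |m| + 1))) (by positivity)
  set B := Set.Icc (fun _ : Fin d => -(k : ℝ)) (fun _ => (k : ℝ)) with hB
  have hBfin : volume B ≠ ⊤ := isCompact_Icc.measure_lt_top.ne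
  set V := volume.real B with hV
  have hV0 : 0 ≤ V := measureReal_nonneg
  set η := ε / (2 * ((C + 1) * V + 1)) with hη
  have hη0 : 0 < η := by positivity
  have hBK : ∀ z ∈ B, rnorm z ≤ rnorm (fun _ : Fin d => (k : ℝ)) := by
    intro z hz
    refine Real.sqrt_le_sqrt (Finset.sum_le_sum fun i _ => ?_)
    exact sq_le_sq' (hz.1 i) (hz.2 i)
  obtain ⟨N₁, hN₁⟩ := hD φ₁ φ₂ h₁ h₂ ⟨C₁, hC₁⟩ ⟨C₂, hC₂⟩ (fun n i => ⌊D n i⌋) hz₀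
    (rnorm fun _ : Fin d => (k : ℝ)) η hη0
  obtain ⟨N₂, hN₂⟩ := hD (fun _ => 1) (fun _ => 1) continuous_const continuous_const
    ⟨1, by simp⟩ ⟨1, by simp⟩ (fun n i => ⌊D n i⌋) hz₀ (rnorm fun _ : Fin d => (k : ℝ)) η hη0
  filter_upwards [eventually_ge_atTop N₁, eventually_ge_atTop N₂, hL.eventually_gt_atTop 0]
    with n hn₁ hn₂ hn c hc
  set z₀ : Fin d → ℤ := fun i => ⌊D n i⌋ with hz₀def
  set h : M → ℝ := fun y => φ₁ y * φ₂ (f^[n] y) with hh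
  have hhm : Measurable h := h₁.measurable.mul (h₂.measurable.comp (hf.iterate n))
  have hhC : ∀ y, |h y| ≤ C := fun y => by
    rw [hh, abs_mul]; exact mul_le_mul (hC₁ _) (hC₂ _) (abs_nonneg _) hC₁0
  have hd₁ : ∀ z ∈ B, |localDensity ν (tauSum f τ n) z₀ (L n) h z - m * p z| ≤ η :=
    fun z hz => hN₁ n hn₁ z (hBK z hz)
  have hd₂ : ∀ z ∈ B, |localDensity ν (tauSum f τ n) z₀ (L n) (fun _ => 1) z - p z| ≤ η :=
    fun z hz => by
      have h := hN₂ n hn₂ z (hBK z hz)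
      simp only [mul_one, integral_const, probReal_univ, smul_eq_mul, one_mul] at h
      exact h
  have hmain := abs_integral_sub_setIntegral_localDensity_le ν (htau n) z₀ hn hhm hhC hc hBfin
  have hint₁ := (setIntegral_mul_localDensity ν (htau n) z₀ (L n) hhm hhC hc hBfin).1
  have hint₂ := (setIntegral_mul_localDensity ν (htau n) z₀ (L n) (h := fun _ => 1)
    measurable_const (C := 1) (by simp) (c := fun _ => 1) (by simp) hBfin).1
  simp only [one_mul] at hint₂
  have hcm : Measurable fun z => c (latticePt z₀ (L n) z) :=
    (Measurable.of_discrete (f := c)).comp (measurable_latticePt z₀ (L n))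
  have hcp : Integrable fun z => c (latticePt z₀ (L n) z) * p z :=
    hpi.bdd_mul hcm.aestronglyMeasurable (ae_of_all _ fun z => hc _)
  have hηV : ∀ g : (Fin d → ℝ) → ℝ, (∀ z ∈ B, |g z| ≤ η) → |∫ z in B, g z| ≤ η * V :=
    fun g hg => by
      simpa only [Real.norm_eq_abs] using norm_setIntegral_le_of_norm_le_const hBfin.lt_top
        (f := g) (by simpa only [Real.norm_eq_abs] using hg)
  have s1 : |(∫ z in B, localDensity ν (tauSum f τ n) z₀ (L n) (fun _ => 1) z) - ∫ z in B, p z| ≤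
      η * V := by
    rw [← integral_sub hint₂ hpi.integrableOn]
    exact hηV _ hd₂
  have s2 : |(∫ z in B, c (latticePt z₀ (L n) z) * localDensity ν (tauSum f τ n) z₀ (L n) h z) -
      m * ∫ z in B, c (latticePt z₀ (L n) z) * p z| ≤ η * V := by
    rw [← integral_const_mul, ← integral_sub hint₁ (hcp.integrableOn.const_mul m)]
    refine hηV _ fun z hz => ?_
    have : c (latticePt z₀ (L n) z) * localDensity ν (tauSum f τ n) z₀ (L n) h z -
        m * (c (latticePt z₀ (L n) z) * p z) = c (latticePt z₀ (L n) z) *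
        (localDensity ν (tauSum f τ n) z₀ (L n) h z - m * p z) := by ring
    rw [this, abs_mul]
    exact (mul_le_of_le_one_left (abs_nonneg _) (hc _)).trans (hd₁ z hz)
  have s3 : |(∫ z, c (latticePt z₀ (L n) z) * p z) - ∫ z in B, c (latticePt z₀ (L n) z) * p z| ≤
      1 - ∫ z in B, p z := by
    have e1 := integral_add_compl (measurableSet_Icc (a := fun _ : Fin d => -(k : ℝ))
      (b := fun _ => (k : ℝ))) hcp
    have e2 := integral_add_compl (measurableSet_Icc (a := fun _ : Fin d => -(k : ℝ))
      (b := fun _ => (k : ℝ))) hpi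
    rw [← hB] at e1 e2
    rw [← e1, add_sub_cancel_left, ← hp1, ← e2, add_sub_cancel_left]
    refine abs_integral_le_integral_abs.trans
      (integral_mono hcp.integrableOn.abs hpi.integrableOn fun z => ?_)
    simp only [abs_mul, abs_of_nonneg (hp0 z)]
    exact mul_le_of_le_one_left (hp0 z) (hc _)
  have hlast : C * (1 - ∫ z in B, localDensity ν (tauSum f τ n) z₀ (L n) (fun _ => 1) z) +
      η * V + |m| * (1 - ∫ z in B, p z) ≤ ε := by
    have hq : C * (1 - ∫ z in B, localDensity ν (tauSum f τ n) z₀ (L n) (fun _ => 1) z) ≤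
        C * (1 - (∫ z in B, p z) + η * V) := by
      gcongr; linarith [abs_le.1 s1]
    have hr : (C + |m|) * (1 - ∫ z in B, p z) ≤ ε / 2 := by
      calc _ ≤ (C + |m| + 1) * (ε / (2 * (C + |m| + 1))) := by
            refine mul_le_mul (by linarith) (by linarith) ((abs_nonneg _).trans s3) (by positivity)
        _ = ε / 2 := by field_simp
    have ht : (C + 1) * (η * V) ≤ ε / 2 := by
      have : η * (2 * ((C + 1) * V + 1)) = ε := by rw [hη]; field_simp
      nlinarith
    nlinarith
  refine le_trans ?_ hlast
  calc _ ≤ |∫ y, h y * c (tauSum f τ n y) ∂ν -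
          ∫ z in B, c (latticePt z₀ (L n) z) * localDensity ν (tauSum f τ n) z₀ (L n) h z| +
        |(∫ z in B, c (latticePt z₀ (L n) z) * localDensity ν (tauSum f τ n) z₀ (L n) h z) -
          m * ∫ z in B, c (latticePt z₀ (L n) z) * p z| +
        |m * (∫ z in B, c (latticePt z₀ (L n) z) * p z) -
          m * ∫ z, c (latticePt z₀ (L n) z) * p z| :=
        (abs_sub_le _ _ _).trans (add_le_add_left (abs_sub_le _ _ _) _)
    _ ≤ _ := by
      gcongr
      rw [← mul_sub, abs_mul, abs_sub_comm]
      gcongr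

section Correlation

variable {Ω : Type*} [MeasurableSpace Ω] {ν : Measure Ω} [IsProbabilityMeasure ν]

theorem integrable_of_forall_abs_le {h : Ω → ℝ} (hh : Measurable h) {C : ℝ}
    (hC : ∀ y, |h y| ≤ C) : Integrable h ν :=
  Integrable.of_bound hh.aestronglyMeasurable C (ae_of_all _ hC)

/-- Stability in `L¹` of weighted correlations. -/
theorem abs_correlation_sub_le {g : Ω → Ω} (hg : MeasurePreserving g ν ν)
    {φ₁ φ₂ ψ₁ ψ₂ c : Ω → ℝ} (hφ₁ : Measurable φ₁) (hφ₂ : Measurable φ₂) (hψ₁ : Measurable ψ₁)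
    (hψ₂ : Measurable ψ₂) (hc : Measurable c) {C₁ C₂ D₁ D₂ : ℝ} (hC₁ : ∀ y, |φ₁ y| ≤ C₁)
    (hC₂ : ∀ y, |φ₂ y| ≤ C₂) (hD₁ : ∀ y, |ψ₁ y| ≤ D₁) (hD₂ : ∀ y, |ψ₂ y| ≤ D₂)
    (hc1 : ∀ y, |c y| ≤ 1) {κ : ℝ} (hκ : |κ| ≤ 1) :
    |(∫ y, φ₁ y * φ₂ (g y) * c y ∂ν - (∫ y, φ₁ y ∂ν) * (∫ y, φ₂ y ∂ν) * κ) -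
      (∫ y, ψ₁ y * ψ₂ (g y) * c y ∂ν - (∫ y, ψ₁ y ∂ν) * (∫ y, ψ₂ y ∂ν) * κ)| ≤
      2 * (C₂ * (∫ y, |φ₁ y - ψ₁ y| ∂ν) + D₁ * ∫ y, |φ₂ y - ψ₂ y| ∂ν) := by
  have : Nonempty Ω := ν.nonempty_of_neZero
  have y₀ := Classical.arbitrary Ω
  have hC₂0 : 0 ≤ C₂ := (abs_nonneg _).trans (hC₂ y₀)
  have hD₁0 : 0 ≤ D₁ := (abs_nonneg _).trans (hD₁ y₀)
  have iφ₁ : Integrable φ₁ ν := integrable_of_forall_abs_le hφ₁ hC₁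
  have iφ₂ : Integrable φ₂ ν := integrable_of_forall_abs_le hφ₂ hC₂
  have iψ₁ : Integrable ψ₁ ν := integrable_of_forall_abs_le hψ₁ hD₁
  have iψ₂ : Integrable ψ₂ ν := integrable_of_forall_abs_le hψ₂ hD₂
  have prodInt : ∀ {a b : Ω → ℝ} {A B : ℝ}, Measurable a → Measurable b → (∀ y, |a y| ≤ A) →
      (∀ y, |b y| ≤ B) → Integrable (fun y => a y * b (g y) * c y) ν := by
    intro a b A B ha hb hA hB
    refine integrable_of_forall_abs_le ((ha.mul (hb.comp hg.measurable)).mul hc)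
      (C := A * B * 1) fun y => ?_
    have hA0 : 0 ≤ A := (abs_nonneg _).trans (hA y)
    have hB0 : 0 ≤ B := (abs_nonneg _).trans (hB y)
    rw [abs_mul, abs_mul]
    gcongr
    exacts [hA y, hB _, hc1 y]
  have i₁ : Integrable (fun y => |φ₁ y - ψ₁ y|) ν := (iφ₁.sub iψ₁).abs
  have i₂ : Integrable (fun y => |φ₂ y - ψ₂ y|) ν := (iφ₂.sub iψ₂).abs
  have i₂g : Integrable (fun y => |φ₂ (g y) - ψ₂ (g y)|) ν :=
    (hg.integrable_comp i₂.aestronglyMeasurable).2 i₂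
  have e₂ : ∫ y, |φ₂ (g y) - ψ₂ (g y)| ∂ν = ∫ y, |φ₂ y - ψ₂ y| ∂ν := by
    have := integral_map (μ := ν) hg.aemeasurable (f := fun y => |φ₂ y - ψ₂ y|)
      (by rw [hg.map_eq]; exact i₂.aestronglyMeasurable)
    rw [hg.map_eq] at this
    exact this.symm
  have hfirst : |∫ y, φ₁ y * φ₂ (g y) * c y ∂ν - ∫ y, ψ₁ y * ψ₂ (g y) * c y ∂ν| ≤
      C₂ * (∫ y, |φ₁ y - ψ₁ y| ∂ν) + D₁ * ∫ y, |φ₂ y - ψ₂ y| ∂ν := by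
    rw [← integral_sub (prodInt hφ₁ hφ₂ hC₁ hC₂) (prodInt hψ₁ hψ₂ hD₁ hD₂), ← e₂,
      ← integral_const_mul, ← integral_const_mul, ← integral_add (i₁.const_mul _)
      (i₂g.const_mul _)]
    refine abs_integral_le_integral_abs.trans (integral_mono
      ((prodInt hφ₁ hφ₂ hC₁ hC₂).sub (prodInt hψ₁ hψ₂ hD₁ hD₂)).abs
      ((i₁.const_mul _).add (i₂g.const_mul _)) fun y => ?_)
    have : φ₁ y * φ₂ (g y) * c y - ψ₁ y * ψ₂ (g y) * c y =
        (φ₂ (g y) * (φ₁ y - ψ₁ y) + ψ₁ y * (φ₂ (g y) - ψ₂ (g y))) * c y := by ring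
    simp only [this]
    rw [abs_mul]
    refine (mul_le_of_le_one_right (abs_nonneg _) (hc1 y)).trans
      ((abs_add_le _ _).trans ?_)
    rw [abs_mul, abs_mul]
    gcongr
    exacts [hC₂ _, hD₁ _]
  have hsecond : |(∫ y, φ₁ y ∂ν) * (∫ y, φ₂ y ∂ν) - (∫ y, ψ₁ y ∂ν) * (∫ y, ψ₂ y ∂ν)| ≤
      C₂ * (∫ y, |φ₁ y - ψ₁ y| ∂ν) + D₁ * ∫ y, |φ₂ y - ψ₂ y| ∂ν := by
    have b : ∀ {a : Ω → ℝ} {A : ℝ}, (∀ y, |a y| ≤ A) → |∫ y, a y ∂ν| ≤ A := by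
      intro a A hA
      have := norm_integral_le_of_norm_le_const (μ := ν) (f := a) (ae_of_all _ hA)
      simpa using this
    have d₁ : |∫ y, φ₁ y ∂ν - ∫ y, ψ₁ y ∂ν| ≤ ∫ y, |φ₁ y - ψ₁ y| ∂ν := by
      rw [← integral_sub iφ₁ iψ₁]; exact abs_integral_le_integral_abs
    have d₂ : |∫ y, φ₂ y ∂ν - ∫ y, ψ₂ y ∂ν| ≤ ∫ y, |φ₂ y - ψ₂ y| ∂ν := by
      rw [← integral_sub iφ₂ iψ₂]; exact abs_integral_le_integral_abs
    have : (∫ y, φ₁ y ∂ν) * (∫ y, φ₂ y ∂ν) - (∫ y, ψ₁ y ∂ν) * (∫ y, ψ₂ y ∂ν) =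
        (∫ y, φ₂ y ∂ν) * (∫ y, φ₁ y ∂ν - ∫ y, ψ₁ y ∂ν) +
        (∫ y, ψ₁ y ∂ν) * (∫ y, φ₂ y ∂ν - ∫ y, ψ₂ y ∂ν) := by ring
    rw [this]
    refine (abs_add_le _ _).trans ?_
    rw [abs_mul, abs_mul]
    exact add_le_add (mul_le_mul (b hC₂) d₁ (abs_nonneg _) hC₂0)
      (mul_le_mul (b hD₁) d₂ (abs_nonneg _) hD₁0)
  set E := C₂ * (∫ y, |φ₁ y - ψ₁ y| ∂ν) + D₁ * ∫ y, |φ₂ y - ψ₂ y| ∂ν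
  have : ∀ a b m m' : ℝ, (a - m * κ) - (b - m' * κ) = (a - b) - (m - m') * κ := by
    intros; ring
  rw [this]
  refine (abs_sub _ _).trans ?_
  rw [abs_mul]
  have := mul_le_of_le_one_right (abs_nonneg
    ((∫ y, φ₁ y ∂ν) * (∫ y, φ₂ y ∂ν) - (∫ y, ψ₁ y ∂ν) * (∫ y, ψ₂ y ∂ν))) hκ
  linarith

end Correlation

/-- The shifted mixing local limit theorem implies convergence of the joint law of
`(y, f^n y, τ_n y)` in total variation with respect to the last coordinate, for bounded measurable
observables. -/
theorem ShiftedMLLT.exists_forall_measurable {d : ℕ} {M : Type*} [MetricSpace M]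
    [MeasurableSpace M] [BorelSpace M] {ν : Measure M} [IsProbabilityMeasure ν]
    {f : M → M} (hf : MeasurePreserving f ν ν) {τ : M → Fin d → ℤ} (hτ : Measurable τ)
    {L : ℕ → ℝ} {p : (Fin d → ℝ) → ℝ} (hMLLT : ShiftedMLLT ν f τ L p) :
    ∃ z₀ : ℕ → Fin d → ℤ, ∀ φ₁ φ₂ : M → ℝ, Measurable φ₁ → Measurable φ₂ →
      (∃ C, ∀ y, |φ₁ y| ≤ C) → (∃ C, ∀ y, |φ₂ y| ≤ C) → ∀ ε > 0, ∀ᶠ n in atTop,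
        ∀ c : (Fin d → ℤ) → ℝ, (∀ u, |c u| ≤ 1) →
          |∫ y, φ₁ y * φ₂ (f^[n] y) * c (tauSum f τ n y) ∂ν -
            (∫ y, φ₁ y ∂ν) * (∫ y, φ₂ y ∂ν) * ∫ z, c (latticePt (z₀ n) (L n) z) * p z| ≤ ε := by
  obtain ⟨z₀, hz₀⟩ := hMLLT.exists_forall_continuous hf.measurable hτ
  obtain ⟨-, -, hp0, hp1, -⟩ := hMLLT
  refine ⟨z₀, ?_⟩
  rintro φ₁ φ₂ h₁ h₂ ⟨C₁, hC₁⟩ ⟨C₂, hC₂⟩ ε hε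
  have : Nonempty M := ν.nonempty_of_neZero
  have hC₂0 : 0 ≤ C₂ := (abs_nonneg _).trans (hC₂ (Classical.arbitrary M))
  obtain ⟨ψ₁, hψ₁, -⟩ := (integrable_of_forall_abs_le (ν := ν) h₁
    hC₁).exists_boundedContinuous_integral_sub_le (ε := ε / (8 * (C₂ + 1))) (by positivity)
  obtain ⟨ψ₂, hψ₂, -⟩ := (integrable_of_forall_abs_le (ν := ν) h₂
    hC₂).exists_boundedContinuous_integral_sub_le (ε := ε / (8 * (‖ψ₁‖ + 1))) (by positivity)
  simp only [Real.norm_eq_abs] at hψ₁ hψ₂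
  filter_upwards [hz₀ ψ₁ ψ₂ ψ₁.continuous ψ₂.continuous ⟨_, ψ₁.norm_coe_le_norm⟩
    ⟨_, ψ₂.norm_coe_le_norm⟩ (ε / 2) (half_pos hε)] with n hn c hc
  have hκ : |∫ z, c (latticePt (z₀ n) (L n) z) * p z| ≤ 1 := by
    rw [← hp1]
    refine abs_integral_le_integral_abs.trans (integral_mono_of_nonneg
      (ae_of_all _ fun z => abs_nonneg _) (integrable_of_integral_eq_one hp1)
      (ae_of_all _ fun z => ?_))
    simp only [abs_mul, abs_of_nonneg (hp0 z)]
    exact mul_le_of_le_one_left (hp0 z) (hc _)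
  have htau : Measurable (tauSum f τ n) :=
    Finset.measurable_fun_sum _ fun j _ => hτ.comp (hf.measurable.iterate j)
  have key := abs_correlation_sub_le (hf.iterate n) h₁ h₂ ψ₁.continuous.measurable
    ψ₂.continuous.measurable ((Measurable.of_discrete (f := c)).comp htau) hC₁ hC₂
    ψ₁.norm_coe_le_norm ψ₂.norm_coe_le_norm (fun y => hc _) hκ
  have b₁ : C₂ * (∫ y, |φ₁ y - ψ₁ y| ∂ν) ≤ ε / 8 := by
    calc _ ≤ (C₂ + 1) * (ε / (8 * (C₂ + 1))) :=
          mul_le_mul (by linarith) hψ₁ (by positivity) (by positivity)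
      _ = ε / 8 := by field_simp
  have b₂ : ‖ψ₁‖ * (∫ y, |φ₂ y - ψ₂ y| ∂ν) ≤ ε / 8 := by
    calc _ ≤ (‖ψ₁‖ + 1) * (ε / (8 * (‖ψ₁‖ + 1))) :=
          mul_le_mul (by linarith) hψ₂ (by positivity) (by positivity)
      _ = ε / 8 := by field_simp
  have h3 := hn c hc
  simp only [Function.comp_apply] at key
  rw [abs_le] at key h3 ⊢
  constructor <;> linarith [key.1, key.2, h3.1, h3.2]

/-- Under the shifted mixing local limit theorem, forward invariant sets are trivial. -/
theorem ShiftedMLLT.measure_eq_zero_or_one {d : ℕ} {M : Type*} [MetricSpace M]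
    [MeasurableSpace M] [BorelSpace M] {ν : Measure M} [IsProbabilityMeasure ν]
    {f : M → M} (hf : MeasurePreserving f ν ν) {τ : M → Fin d → ℤ} (hτ : Measurable τ)
    {L : ℕ → ℝ} {p : (Fin d → ℝ) → ℝ} (hMLLT : ShiftedMLLT ν f τ L p) {B : Set M}
    (hB : MeasurableSet B) (hBf : B ⊆ f ⁻¹' B) : ν B = 0 ∨ ν B = 1 := by
  obtain ⟨z₀, hz₀⟩ := hMLLT.exists_forall_measurable hf hτ
  have hp1 := hMLLT.2.2.2.1
  have hind : ∀ s : Set M, ∀ y, |s.indicator (fun _ => (1 : ℝ)) y| ≤ 1 := by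
    intro s y
    by_cases h : y ∈ s <;> simp [h]
  have hiter : ∀ n y, y ∈ B → f^[n] y ∈ B := by
    intro n
    induction n with
    | zero => exact fun y hy => hy
    | succ n ih =>
      intro y hy
      rw [Function.iterate_succ_apply]
      exact ih _ (hBf hy)
  have hBc : Measurable (Bᶜ.indicator fun _ => (1 : ℝ)) := measurable_const.indicator hB.compl
  have hBm : Measurable (B.indicator fun _ => (1 : ℝ)) := measurable_const.indicator hB
  have hzero : ∀ n y, B.indicator (fun _ => (1 : ℝ)) y *
      Bᶜ.indicator (fun _ => (1 : ℝ)) (f^[n] y) = 0 := by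
    intro n y
    by_cases h : y ∈ B
    · simp [hiter n y h]
    · simp [h]
  have hprod : ν.real B * ν.real Bᶜ = 0 := by
    refine abs_nonpos_iff.1 (le_of_forall_pos_le_add fun ε hε => ?_)
    obtain ⟨n, hn⟩ := (hz₀ _ _ hBm hBc ⟨1, hind B⟩ ⟨1, hind Bᶜ⟩ ε hε).exists
    have := hn (fun _ => 1) (by simp)
    simpa [hzero, integral_indicator_const, hB, hB.compl, hp1] using this
  rw [probReal_compl_eq_one_sub hB, mul_eq_zero] at hprod
  rcases hprod with h | h
  · left
    simpa [Measure.real, ENNReal.toReal_eq_zero_iff] using h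
  · right
    have h1 : ν.real B = 1 := by linarith
    rw [Measure.real, ENNReal.toReal_eq_one_iff] at h1
    exact h1

/-- Approximation of a bounded equicontinuous family of functions by finite-rank ones, up to an
error which is uniform in the parameter and small in `L¹`. -/
theorem exists_finite_rank_approx {ι M : Type*} [MetricSpace M] [LocallyCompactSpace M]
    [MeasurableSpace M] [BorelSpace M] [Countable ι] (ν : Measure M) [IsProbabilityMeasure ν]
    {f : M → M} (hf : Measurable f)
    (hinv : ∀ B, MeasurableSet B → B ⊆ f ⁻¹' B → ν B = 0 ∨ ν B = 1)
    (Φ : M → ι → ℝ) (hΦm : ∀ u, Measurable fun y => Φ y u) {C : ℝ} (hC0 : 0 ≤ C)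
    (hC : ∀ y u, |Φ y u| ≤ C)
    (hΦ : ∀ ε > 0, ∃ δ > 0, ∀ y y', dist y y' < δ → ∀ u, |Φ y u - Φ y' u| ≤ ε)
    {ε : ℝ} (hε : 0 < ε) :
    ∃ (N : ℕ) (e : ℕ → M → ℝ) (c : ℕ → ι → ℝ) (χ : M → ℝ),
      (∀ k, Measurable (e k)) ∧ (∀ k y, |e k y| ≤ 1) ∧ (∀ k u, |c k u| ≤ C) ∧
      (∀ y u, |∑ k ∈ Finset.range N, e k y * c k u| ≤ C) ∧
      Measurable χ ∧ (∀ y, |χ y| ≤ ε + C) ∧ (∫ y, χ y ∂ν) ≤ ε ∧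
      ∀ᵐ y ∂ν, ∀ u, |Φ y u - ∑ k ∈ Finset.range N, e k y * c k u| ≤ χ y := by
  classical
  obtain ⟨s, hs⟩ := exists_seq_ae_forall_abs_sub_le ν hf hinv Φ hΦ
  let A : ℕ → Set M := fun k => {y | ∀ u, |Φ y u - Φ (s k) u| ≤ ε / 2}
  have hA : ∀ k, MeasurableSet (A k) := by
    intro k
    have : A k = ⋂ u, {y | |Φ y u - Φ (s k) u| ≤ ε / 2} := by ext; simp [A]
    rw [this]
    exact MeasurableSet.iInter fun u =>
      measurableSet_le ((hΦm u).sub_const _).abs measurable_const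
  let R : ℕ → Set M := fun N => (⋃ k ∈ Finset.range N, A k)ᶜ
  have hR : ∀ N, MeasurableSet (R N) := fun N =>
    (Finset.measurableSet_biUnion _ fun k _ => hA k).compl
  have hR0 : Tendsto (fun N => ν (R N)) atTop (𝓝 0) := by
    have hanti : Antitone R := fun N N' h =>
      Set.compl_subset_compl.2 (Set.biUnion_subset_biUnion_left fun k hk => by
        simp only [Finset.coe_range, Set.mem_Iio] at hk ⊢
        exact hk.trans_le h)
    have h := tendsto_measure_iInter_atTop (μ := ν) (fun N => (hR N).nullMeasurableSet) hanti
      ⟨0, measure_ne_top _ _⟩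
    have h0 : ν (⋂ N, R N) = 0 := by
      rw [measure_eq_zero_iff_ae_notMem]
      filter_upwards [hs (ε / 2) (half_pos hε)] with y ⟨k, hk⟩ hy
      have := Set.mem_iInter.1 hy (k + 1)
      exact this (Set.mem_biUnion (x := k) (by simp) hk)
    rwa [h0] at h
  have hR1 : Tendsto (fun N => ε / 2 + C * ν.real (R N)) atTop (𝓝 (ε / 2 + C * 0)) :=
    (((ENNReal.tendsto_toReal ENNReal.zero_ne_top).comp hR0).const_mul C).const_add _
  have hlt : ε / 2 + C * 0 < ε := by linarith
  obtain ⟨N, hN⟩ := (hR1.eventually (gt_mem_nhds hlt)).exists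
  let E : ℕ → Set M := disjointed A
  have hE : ∀ k, MeasurableSet (E k) := MeasurableSet.disjointed hA
  have hsum : ∀ y u k, k < N → y ∈ E k →
      ∑ k ∈ Finset.range N, (E k).indicator (fun _ => (1 : ℝ)) y * Φ (s k) u = Φ (s k) u := by
    intro y u k hk hy
    rw [Finset.sum_eq_single_of_mem k (Finset.mem_range.2 hk), Set.indicator_of_mem hy, one_mul]
    intro j _ hj
    rw [Set.indicator_of_notMem, zero_mul]
    intro hyj
    exact Set.disjoint_left.1 (disjoint_disjointed A hj) hyj hy
  have hsum0 : ∀ y u, (∀ k < N, y ∉ E k) →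
      ∑ k ∈ Finset.range N, (E k).indicator (fun _ => (1 : ℝ)) y * Φ (s k) u = 0 := by
    intro y u h
    refine Finset.sum_eq_zero fun k hk => ?_
    rw [Set.indicator_of_notMem (h k (Finset.mem_range.1 hk)), zero_mul]
  have hind : ∀ (S : Set M) y, |S.indicator (fun _ => (1 : ℝ)) y| ≤ 1 := by
    intro S y
    by_cases h : y ∈ S <;> simp [h]
  refine ⟨N, fun k => (E k).indicator fun _ => 1, fun k => Φ (s k),
    fun y => ε / 2 + C * (R N).indicator (fun _ => 1) y,
    fun k => measurable_const.indicator (hE k), fun k y => hind _ y, fun k u => hC _ u, ?_,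
    ((measurable_const.indicator (hR N)).const_mul C).const_add _, ?_, ?_, ?_⟩
  · intro y u
    by_cases h : ∀ k < N, y ∉ E k
    · rw [hsum0 y u h, abs_zero]; exact hC0
    · push Not at h
      obtain ⟨k, hk, hy⟩ := h
      rw [hsum y u k hk hy]
      exact hC _ _
  · intro y
    by_cases h : y ∈ R N
    · simp only [h, Set.indicator_of_mem]
      rw [abs_of_nonneg (by positivity)]; linarith
    · simp only [h, not_false_eq_true, Set.indicator_of_notMem]
      rw [abs_of_nonneg (by linarith)]; linarith
  · rw [integral_add (integrable_const _)
      (((integrable_const (1 : ℝ)).indicator (hR N)).const_mul C), integral_const_mul,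
      integral_indicator_const _ (hR N)]
    simp only [integral_const, probReal_univ, smul_eq_mul, one_mul, mul_one]
    exact hN.le
  · refine ae_of_all _ fun y u => ?_
    by_cases h : ∀ k < N, y ∉ E k
    · rw [hsum0 y u h, sub_zero]
      have hy : y ∈ R N := by
        intro hy
        simp only [Finset.mem_range, Set.mem_iUnion, exists_prop] at hy
        obtain ⟨k, hk, hyk⟩ := hy
        have : y ∈ ⋃ i ∈ Finset.Iic k, disjointed A i := by
          rw [biUnion_Iic_disjointed]
          exact le_partialSups A k hyk
        simp only [Set.mem_iUnion, exists_prop, Finset.mem_Iic] at this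
        obtain ⟨i, hi, hyi⟩ := this
        exact h i (hi.trans_lt hk) hyi
      simp only [hy, Set.indicator_of_mem]
      have := hC y u
      linarith
    · push Not at h
      obtain ⟨k, hk, hy⟩ := h
      rw [hsum y u k hk hy]
      have h1 : |Φ y u - Φ (s k) u| ≤ ε / 2 := (disjointed_subset A k hy : y ∈ A k) u
      have h2 : 0 ≤ C * (R N).indicator (fun _ => (1 : ℝ)) y :=
        mul_nonneg hC0 (Set.indicator_nonneg (fun _ _ => zero_le_one) _)
      linarith

/-- Continuity of translations in `L¹` at a continuous probability density. -/
theorem tendsto_integral_abs_sub_translate {d : ℕ} {p : (Fin d → ℝ) → ℝ} (hpc : Continuous p)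
    (hp0 : ∀ z, 0 ≤ p z) (hp : Integrable p) {t : ℕ → Fin d → ℝ} (ht : Tendsto t atTop (𝓝 0)) :
    Tendsto (fun n => ∫ z, |p (z - t n) - p z|) atTop (𝓝 0) := by
  have hpos : Tendsto (fun n => ∫ z, max (p z - p (z - t n)) 0) atTop (𝓝 (∫ _ : Fin d → ℝ, (0 : ℝ))) := by
    refine tendsto_integral_of_dominated_convergence p (fun n => ?_) hp
      (fun n => ae_of_all _ fun z => ?_) (ae_of_all _ fun z => ?_)
    · exact Continuous.aestronglyMeasurable (by fun_prop)
    · rw [Real.norm_eq_abs, abs_of_nonneg (le_max_right _ _)]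
      exact max_le (by linarith [hp0 (z - t n)]) (hp0 z)
    · have h : Tendsto (fun n => p (z - t n)) atTop (𝓝 (p (z - 0))) :=
        (hpc.tendsto _).comp (ht.const_sub z)
      simpa using (h.const_sub (p z)).max (tendsto_const_nhds (x := (0 : ℝ)))
  have heq : ∀ n, ∫ z, |p (z - t n) - p z| = 2 * ∫ z, max (p z - p (z - t n)) 0 := by
    intro n
    have hpt : Integrable fun z => p (z - t n) := hp.comp_sub_right (t n)
    have hmax : Integrable fun z => max (p z - p (z - t n)) 0 := (hp.sub hpt).pos_part
    have h1 : ∀ z, |p (z - t n) - p z| =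
        2 * max (p z - p (z - t n)) 0 - (p z - p (z - t n)) := by
      intro z
      rcases le_total (p z) (p (z - t n)) with h | h
      · rw [max_eq_right (by linarith), abs_of_nonneg (by linarith)]; ring
      · rw [max_eq_left (by linarith), abs_of_nonpos (by linarith)]; ring
    simp_rw [h1]
    have hsub : Integrable fun z => p z - p (z - t n) := hp.sub hpt
    have hd : ∫ z, (p z - p (z - t n)) = 0 := by
      rw [integral_sub hp hpt, integral_sub_right_eq_self, sub_self]
    rw [integral_sub (hmax.const_mul 2) hsub, hd, integral_const_mul, sub_zero]
  simp_rw [heq]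
  simpa using hpos.const_mul 2

theorem latticePt_add_smul {d : ℕ} (z₀ : Fin d → ℤ) {ℓ : ℝ} (hℓ : 0 < ℓ) (z : Fin d → ℝ)
    (j : Fin d → ℤ) :
    latticePt z₀ ℓ (z + ℓ⁻¹ • fun i => (j i : ℝ)) = latticePt z₀ ℓ z + j := by
  ext i
  have : (z i + ℓ⁻¹ * (j i : ℝ)) * ℓ = z i * ℓ + j i := by field_simp
  simp only [latticePt, Pi.add_apply, Pi.smul_apply, smul_eq_mul, this, Int.floor_add_intCast]
  ring

theorem add_latticePt {d : ℕ} (u z₀ : Fin d → ℤ) (ℓ : ℝ) (z : Fin d → ℝ) :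
    u + latticePt z₀ ℓ z = latticePt (u + z₀) ℓ z := (add_assoc _ _ _).symm

theorem integrable_comp_latticePt_mul {d : ℕ} {p : (Fin d → ℝ) → ℝ} (hp : Integrable p)
    (z₀ : Fin d → ℤ) (ℓ : ℝ) {G : (Fin d → ℤ) → ℝ} {C : ℝ} (hG : ∀ u, |G u| ≤ C) :
    Integrable fun z => G (latticePt z₀ ℓ z) * p z :=
  hp.bdd_mul (c := C) ((Measurable.of_discrete (f := G)).comp
    (measurable_latticePt z₀ ℓ)).aestronglyMeasurable (ae_of_all _ fun _ => hG _)

theorem abs_integral_mul_le_of_forall_abs_le {d : ℕ} {p : (Fin d → ℝ) → ℝ} (hp0 : ∀ z, 0 ≤ p z)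
    (hp : Integrable p) (hp1 : ∫ z, p z = 1) {g : (Fin d → ℝ) → ℝ} {η : ℝ}
    (hg : ∀ z, |g z| ≤ η) : |∫ z, g z * p z| ≤ η := by
  calc |∫ z, g z * p z| ≤ ∫ z, η * p z :=
        norm_integral_le_of_norm_le (f := fun z => g z * p z) (hp.const_mul η)
          (ae_of_all _ fun z => by
            rw [Real.norm_eq_abs, abs_mul, abs_of_nonneg (hp0 z)]
            exact mul_le_mul_of_nonneg_right (hg z) (hp0 z))
    _ = η := by rw [integral_const_mul, hp1, mul_one]

/-- A function on the lattice with uniform averages equal to `g` averages to `g` against a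
density spread out at a large scale. -/
theorem eventually_abs_integral_latticePt_sub_le {d : ℕ} {p : (Fin d → ℝ) → ℝ}
    (hpc : Continuous p) (hp0 : ∀ z, 0 ≤ p z) (hp1 : ∫ z, p z = 1) {L : ℕ → ℝ}
    (hL : Tendsto L atTop atTop) {G : (Fin d → ℤ) → ℝ} {C : ℝ} (hC : ∀ u, |G u| ≤ C) {g : ℝ}
    (hG : ∀ ε > 0, ∃ Q : Finset (Fin d → ℤ), Q.Nonempty ∧
      ∀ v, |(Q.card : ℝ)⁻¹ * (∑ j ∈ Q, G (v + j)) - g| ≤ ε) {ε : ℝ} (hε : 0 < ε) :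
    ∀ᶠ n in atTop, ∀ z₀, |(∫ z, G (latticePt z₀ (L n) z) * p z) - g| ≤ ε := by
  have hp : Integrable p := by
    by_contra h
    rw [integral_undef h] at hp1
    exact zero_ne_one hp1
  have hC0 : 0 ≤ C := (abs_nonneg _).trans (hC 0)
  obtain ⟨Q, hQ, hQG⟩ := hG (ε / 2) (half_pos hε)
  have hL0 : Tendsto (fun n => (L n)⁻¹) atTop (𝓝 0) := tendsto_inv_atTop_zero.comp hL
  have htr : ∀ j ∈ Q, ∀ᶠ n in atTop,
      C * ∫ z, |p (z - (L n)⁻¹ • fun i => (j i : ℝ)) - p z| ≤ ε / 2 := by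
    intro j _
    have h0 : Tendsto (fun n => (L n)⁻¹ • fun i => (j i : ℝ)) atTop (𝓝 (0 : Fin d → ℝ)) := by
      simpa using hL0.smul_const (fun i => (j i : ℝ))
    have := (tendsto_integral_abs_sub_translate hpc hp0 hp h0).const_mul C
    rw [mul_zero] at this
    exact (this.eventually (gt_mem_nhds (half_pos hε))).mono fun n hn => hn.le
  filter_upwards [(Filter.eventually_all_finset Q).2 htr, hL.eventually_gt_atTop 0] with n hn hLn z₀
  have hI : ∀ j : Fin d → ℤ, Integrable fun z => G (latticePt z₀ (L n) z + j) * p z := fun j =>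
    integrable_comp_latticePt_mul hp z₀ (L n) (G := fun u => G (u + j)) fun u => hC _
  have hshift : ∀ j ∈ Q, |(∫ z, G (latticePt z₀ (L n) z) * p z) -
      ∫ z, G (latticePt z₀ (L n) z + j) * p z| ≤ ε / 2 := by
    intro j hj
    set t : Fin d → ℝ := (L n)⁻¹ • fun i => (j i : ℝ) with ht
    have h1 : ∫ z, G (latticePt z₀ (L n) z + j) * p z =
        ∫ z, G (latticePt z₀ (L n) z) * p (z - t) := by
      rw [← integral_add_right_eq_self (fun z => G (latticePt z₀ (L n) z) * p (z - t)) t]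
      simp only [ht, latticePt_add_smul z₀ hLn, add_sub_cancel_right]
    have hpt : Integrable fun z => p (z - t) := hp.comp_sub_right t
    have hi : Integrable fun z => G (latticePt z₀ (L n) z) * p z :=
      integrable_comp_latticePt_mul hp z₀ (L n) hC
    rw [h1, ← integral_sub hi (integrable_comp_latticePt_mul hpt z₀ (L n) hC)]
    refine le_trans ?_ (hn j hj)
    rw [← integral_const_mul]
    refine (Real.norm_eq_abs _).symm.trans_le
      (norm_integral_le_of_norm_le ((hpt.sub hp).abs.const_mul C) (ae_of_all _ fun z => ?_))
    rw [← mul_sub, Real.norm_eq_abs, abs_mul, abs_sub_comm (p z)]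
    exact mul_le_mul_of_nonneg_right (hC _) (abs_nonneg _)
  have hq : (0 : ℝ) < Q.card := by exact_mod_cast hQ.card_pos
  have hmean : |(Q.card : ℝ)⁻¹ * (∑ j ∈ Q, ∫ z, G (latticePt z₀ (L n) z + j) * p z) - g| ≤
      ε / 2 := by
    have h : (Q.card : ℝ)⁻¹ * (∑ j ∈ Q, ∫ z, G (latticePt z₀ (L n) z + j) * p z) - g =
        ∫ z, ((Q.card : ℝ)⁻¹ * (∑ j ∈ Q, G (latticePt z₀ (L n) z + j)) - g) * p z := by
      rw [← integral_finsetSum _ fun j _ => hI j, ← integral_const_mul]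
      conv_lhs => rw [← mul_one g, ← hp1, ← integral_const_mul]
      rw [← integral_sub ((integrable_finsetSum _ fun j _ => hI j).const_mul _)
        (hp.const_mul g)]
      refine integral_congr_ae (ae_of_all _ fun z => ?_)
      simp only [← Finset.sum_mul]
      ring
    rw [h]
    exact abs_integral_mul_le_of_forall_abs_le hp0 hp hp1 fun z => hQG _
  have hdiff : |(∫ z, G (latticePt z₀ (L n) z) * p z) -
      (Q.card : ℝ)⁻¹ * ∑ j ∈ Q, ∫ z, G (latticePt z₀ (L n) z + j) * p z| ≤ ε / 2 := by
    have h : (∫ z, G (latticePt z₀ (L n) z) * p z) -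
        (Q.card : ℝ)⁻¹ * ∑ j ∈ Q, ∫ z, G (latticePt z₀ (L n) z + j) * p z =
        (Q.card : ℝ)⁻¹ * ∑ j ∈ Q, ((∫ z, G (latticePt z₀ (L n) z) * p z) -
          ∫ z, G (latticePt z₀ (L n) z + j) * p z) := by
      rw [Finset.sum_sub_distrib, Finset.sum_const, nsmul_eq_mul, mul_sub, inv_mul_cancel_left₀ hq.ne']
    rw [h, abs_mul, abs_of_nonneg (inv_nonneg.2 hq.le), inv_mul_le_iff₀ hq]
    refine (Finset.abs_sum_le_sum_abs _ _).trans ?_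
    simpa using Finset.sum_le_card_nsmul Q _ (ε / 2) hshift
  calc _ ≤ _ := abs_sub_le _ _ _
    _ ≤ ε / 2 + ε / 2 := add_le_add hdiff hmean
    _ = ε := add_halves ε

section FiniteRank

variable {d : ℕ} {Ω : Type*} [MeasurableSpace Ω] {ν : Measure Ω} [IsProbabilityMeasure ν]

/-- Correlations of finite-rank observables are controlled by those of their factors. -/
theorem abs_finite_rank_correlation_sub_le {g : Ω → Ω} (hg : Measurable g) {t : Ω → Fin d → ℤ}
    (ht : Measurable t) {p : (Fin d → ℝ) → ℝ} (hp : Integrable p) (z₀ : Fin d → ℤ) (ℓ : ℝ)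
    {N₁ N₂ : ℕ} {e₁ e₂ : ℕ → Ω → ℝ} {c₁ c₂ : ℕ → (Fin d → ℤ) → ℝ}
    (he₁ : ∀ k, Measurable (e₁ k)) (he₂ : ∀ k, Measurable (e₂ k))
    (hb₁ : ∀ k y, |e₁ k y| ≤ 1) (hb₂ : ∀ k y, |e₂ k y| ≤ 1) {C : ℝ} (hC : 0 < C)
    (hc₁ : ∀ k u, |c₁ k u| ≤ C) (hc₂ : ∀ k u, |c₂ k u| ≤ C) {δ : ℝ}
    (h : ∀ k ∈ Finset.range N₁, ∀ l ∈ Finset.range N₂, ∀ c : (Fin d → ℤ) → ℝ, (∀ u, |c u| ≤ 1) →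
      |∫ y, e₁ k y * e₂ l (g y) * c (t y) ∂ν -
        (∫ y, e₁ k y ∂ν) * (∫ y, e₂ l y ∂ν) * ∫ z, c (latticePt z₀ ℓ z) * p z| ≤ δ)
    (u : Fin d → ℤ) :
    |∫ y, (∑ k ∈ Finset.range N₁, e₁ k y * c₁ k u) *
          (∑ l ∈ Finset.range N₂, e₂ l (g y) * c₂ l (u + t y)) ∂ν -
        (∫ y, ∑ k ∈ Finset.range N₁, e₁ k y * c₁ k u ∂ν) *
          ∫ z, (∫ y, ∑ l ∈ Finset.range N₂, e₂ l y * c₂ l (u + latticePt z₀ ℓ z) ∂ν) * p z| ≤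
      N₁ * (N₂ * (C * (C * δ))) := by
  have i₁ : ∀ k, Integrable (e₁ k) ν := fun k => integrable_of_forall_abs_le (he₁ k) (hb₁ k)
  have i₂ : ∀ k, Integrable (e₂ k) ν := fun k => integrable_of_forall_abs_le (he₂ k) (hb₂ k)
  let b : ℕ → (Fin d → ℤ) → ℝ := fun l v => c₂ l (u + v)
  have hbm : ∀ l, Measurable fun y => b l (t y) := fun l =>
    (Measurable.of_discrete (f := b l)).comp ht
  have hbb : ∀ l v, |b l v| ≤ C := fun l v => hc₂ l _
  have i₁₂ : ∀ k l, Integrable (fun y => e₁ k y * e₂ l (g y) * b l (t y)) ν := by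
    intro k l
    refine integrable_of_forall_abs_le (((he₁ k).mul ((he₂ l).comp hg)).mul (hbm l))
      (C := 1 * 1 * C) fun y => ?_
    rw [abs_mul, abs_mul]
    gcongr
    exacts [hb₁ k y, hb₂ l _, hbb l _]
  have ib : ∀ l, Integrable fun z => b l (latticePt z₀ ℓ z) * p z := fun l =>
    integrable_comp_latticePt_mul hp z₀ ℓ (hbb l)
  have hX : ∫ y, (∑ k ∈ Finset.range N₁, e₁ k y * c₁ k u) *
      (∑ l ∈ Finset.range N₂, e₂ l (g y) * c₂ l (u + t y)) ∂ν =
      ∑ k ∈ Finset.range N₁, ∑ l ∈ Finset.range N₂,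
        c₁ k u * ∫ y, e₁ k y * e₂ l (g y) * b l (t y) ∂ν := by
    have : ∀ y, (∑ k ∈ Finset.range N₁, e₁ k y * c₁ k u) *
        (∑ l ∈ Finset.range N₂, e₂ l (g y) * c₂ l (u + t y)) =
        ∑ k ∈ Finset.range N₁, ∑ l ∈ Finset.range N₂,
          c₁ k u * (e₁ k y * e₂ l (g y) * b l (t y)) := by
      intro y
      rw [Finset.sum_mul_sum]
      exact Finset.sum_congr rfl fun k _ => Finset.sum_congr rfl fun l _ => by ring
    simp_rw [this]
    rw [integral_finsetSum _ fun k _ => integrable_finsetSum _ fun l _ => (i₁₂ k l).const_mul _]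
    refine Finset.sum_congr rfl fun k _ => ?_
    rw [integral_finsetSum _ fun l _ => (i₁₂ k l).const_mul _]
    exact Finset.sum_congr rfl fun l _ => integral_const_mul _ _
  have hY₁ : ∫ y, ∑ k ∈ Finset.range N₁, e₁ k y * c₁ k u ∂ν =
      ∑ k ∈ Finset.range N₁, c₁ k u * ∫ y, e₁ k y ∂ν := by
    rw [integral_finsetSum _ fun k _ => (i₁ k).mul_const _]
    exact Finset.sum_congr rfl fun k _ => by rw [integral_mul_const, mul_comm]
  have hY₂ : ∫ z, (∫ y, ∑ l ∈ Finset.range N₂, e₂ l y * c₂ l (u + latticePt z₀ ℓ z) ∂ν) * p z =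
      ∑ l ∈ Finset.range N₂, (∫ y, e₂ l y ∂ν) * ∫ z, b l (latticePt z₀ ℓ z) * p z := by
    have : ∀ z, (∫ y, ∑ l ∈ Finset.range N₂, e₂ l y * c₂ l (u + latticePt z₀ ℓ z) ∂ν) * p z =
        ∑ l ∈ Finset.range N₂, (∫ y, e₂ l y ∂ν) * (b l (latticePt z₀ ℓ z) * p z) := by
      intro z
      rw [integral_finsetSum _ fun k _ => (i₂ k).mul_const _, Finset.sum_mul]
      exact Finset.sum_congr rfl fun k _ => by rw [integral_mul_const, mul_assoc]
    simp_rw [this]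
    rw [integral_finsetSum _ fun l _ => (ib l).const_mul _]
    exact Finset.sum_congr rfl fun l _ => integral_const_mul _ _
  have hterm : ∀ k ∈ Finset.range N₁, ∀ l ∈ Finset.range N₂,
      |c₁ k u * (∫ y, e₁ k y * e₂ l (g y) * b l (t y) ∂ν) -
        c₁ k u * (∫ y, e₁ k y ∂ν) * ((∫ y, e₂ l y ∂ν) * ∫ z, b l (latticePt z₀ ℓ z) * p z)| ≤
      C * (C * δ) := by
    intro k hk l hl
    have hscale := h k hk l hl (fun v => C⁻¹ * b l v) fun v => by
      rw [abs_mul, abs_inv, abs_of_pos hC, inv_mul_le_iff₀ hC, mul_one]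
      exact hbb l v
    have e1 : ∫ y, e₁ k y * e₂ l (g y) * (C⁻¹ * b l (t y)) ∂ν =
        C⁻¹ * ∫ y, e₁ k y * e₂ l (g y) * b l (t y) ∂ν := by
      rw [← integral_const_mul]
      exact integral_congr_ae (ae_of_all _ fun y => by ring)
    have e2 : ∫ z, C⁻¹ * b l (latticePt z₀ ℓ z) * p z =
        C⁻¹ * ∫ z, b l (latticePt z₀ ℓ z) * p z := by
      rw [← integral_const_mul]
      exact integral_congr_ae (ae_of_all _ fun y => by ring)
    rw [e1, e2] at hscale
    rw [show ∀ a X m m' K : ℝ, a * X - a * m * (m' * K) =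
      a * (C * (C⁻¹ * X - m * m' * (C⁻¹ * K))) from fun a X m m' K => by field_simp,
      abs_mul, abs_mul, abs_of_pos hC]
    gcongr
    exact hc₁ k u
  rw [hX, hY₁, hY₂, Finset.sum_mul_sum, ← Finset.sum_sub_distrib]
  calc _ ≤ ∑ k ∈ Finset.range N₁, ∑ l ∈ Finset.range N₂, C * (C * δ) := by
        refine (Finset.abs_sum_le_sum_abs _ _).trans (Finset.sum_le_sum fun k hk => ?_)
        rw [← Finset.sum_sub_distrib]
        exact (Finset.abs_sum_le_sum_abs _ _).trans (Finset.sum_le_sum fun l hl => hterm k hk l hl)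
    _ = _ := by simp

theorem abs_integral_mul_sub_integral_mul_le {a₁ a₂ b₁ b₂ χ₁ χ₂ : Ω → ℝ} (ha₁ : Measurable a₁)
    (ha₂ : Measurable a₂) (hb₁ : Measurable b₁) (hb₂ : Measurable b₂) {C : ℝ}
    (hCa₁ : ∀ y, |a₁ y| ≤ C) (hCa₂ : ∀ y, |a₂ y| ≤ C) (hCb₁ : ∀ y, |b₁ y| ≤ C)
    (hCb₂ : ∀ y, |b₂ y| ≤ C) (hχ₁ : Integrable χ₁ ν) (hχ₂ : Integrable χ₂ ν)
    (h₁ : ∀ᵐ y ∂ν, |a₁ y - b₁ y| ≤ χ₁ y) (h₂ : ∀ᵐ y ∂ν, |a₂ y - b₂ y| ≤ χ₂ y) :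
    |(∫ y, a₁ y * a₂ y ∂ν) - ∫ y, b₁ y * b₂ y ∂ν| ≤
      C * (∫ y, χ₁ y ∂ν) + C * ∫ y, χ₂ y ∂ν := by
  have : Nonempty Ω := ν.nonempty_of_neZero
  have hC0 : 0 ≤ C := (abs_nonneg _).trans (hCa₁ (Classical.arbitrary Ω))
  have hprod : ∀ {a b : Ω → ℝ}, Measurable a → Measurable b → (∀ y, |a y| ≤ C) →
      (∀ y, |b y| ≤ C) → Integrable (fun y => a y * b y) ν := by
    intro a b ha hb hA hB
    refine integrable_of_forall_abs_le (ha.mul hb) (C := C * C) fun y => ?_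
    rw [abs_mul]
    gcongr
    exacts [hA y, hB y]
  rw [← integral_sub (hprod ha₁ ha₂ hCa₁ hCa₂) (hprod hb₁ hb₂ hCb₁ hCb₂), ← integral_const_mul,
    ← integral_const_mul, ← integral_add (hχ₁.const_mul C) (hχ₂.const_mul C)]
  refine (Real.norm_eq_abs _).symm.trans_le
    (norm_integral_le_of_norm_le ((hχ₁.const_mul C).add (hχ₂.const_mul C)) ?_)
  filter_upwards [h₁, h₂] with y h₁ h₂
  rw [Real.norm_eq_abs, show a₁ y * a₂ y - b₁ y * b₂ y =
    a₂ y * (a₁ y - b₁ y) + b₁ y * (a₂ y - b₂ y) by ring]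
  refine (abs_add_le _ _).trans ?_
  rw [abs_mul, abs_mul]
  gcongr
  exacts [hCa₂ y, hCb₁ y]

end FiniteRank

theorem measurable_tauSum {d : ℕ} {M : Type*} [MeasurableSpace M] {f : M → M} (hf : Measurable f)
    {τ : M → Fin d → ℤ} (hτ : Measurable τ) (n : ℕ) : Measurable (tauSum f τ n) :=
  Finset.measurable_fun_sum _ fun j _ => hτ.comp (hf.iterate j)

/-- Under a shifted MLLT, correlations of observables decouple, uniformly over the fibres. -/
theorem ShiftedMLLT.eventually_abs_correlation_sub_le {d : ℕ} {M : Type*} [MetricSpace M]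
    [LocallyCompactSpace M] [MeasurableSpace M] [BorelSpace M] {ν : Measure M}
    [IsProbabilityMeasure ν] {f : M → M} (hf : MeasurePreserving f ν ν) {τ : M → Fin d → ℤ}
    (hτ : Measurable τ) {L : ℕ → ℝ} {p : (Fin d → ℝ) → ℝ} (hMLLT : ShiftedMLLT ν f τ L p)
    {Φ₁ Φ₂ : M → (Fin d → ℤ) → ℝ} (hm₁ : ∀ u, Measurable fun y => Φ₁ y u)
    (hm₂ : ∀ u, Measurable fun y => Φ₂ y u) {C : ℝ} (hC : 0 < C)
    (hC₁ : ∀ y u, |Φ₁ y u| ≤ C) (hC₂ : ∀ y u, |Φ₂ y u| ≤ C)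
    (hu₁ : ∀ ε > 0, ∃ δ > 0, ∀ y y', dist y y' < δ → ∀ u, |Φ₁ y u - Φ₁ y' u| ≤ ε)
    (hu₂ : ∀ ε > 0, ∃ δ > 0, ∀ y y', dist y y' < δ → ∀ u, |Φ₂ y u - Φ₂ y' u| ≤ ε)
    {g : ℝ} (hg : ∀ ε > 0, ∃ Q : Finset (Fin d → ℤ), Q.Nonempty ∧
      ∀ v, |(Q.card : ℝ)⁻¹ * (∑ j ∈ Q, ∫ y, Φ₂ y (v + j) ∂ν) - g| ≤ ε) {ε : ℝ} (hε : 0 < ε) :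
    ∀ᶠ n in atTop, ∀ u, |∫ y, Φ₁ y u * Φ₂ (f^[n] y) (u + tauSum f τ n y) ∂ν -
      (∫ y, Φ₁ y u ∂ν) * g| ≤ ε := by
  obtain ⟨z₀, hz₀⟩ := hMLLT.exists_forall_measurable hf hτ
  have hinv : ∀ B, MeasurableSet B → B ⊆ f ⁻¹' B → ν B = 0 ∨ ν B = 1 := fun B =>
    hMLLT.measure_eq_zero_or_one hf hτ
  obtain ⟨hL, hpc, hp0, hp1, -⟩ := hMLLT
  have hp : Integrable p := by
    by_contra h
    rw [integral_undef h] at hp1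
    exact zero_ne_one hp1
  set η : ℝ := ε / (10 * C) with hη
  have hη0 : 0 < η := by positivity
  have hCη : C * η = ε / 10 := by rw [hη]; field_simp
  obtain ⟨N₁, e₁, c₁, χ₁, he₁, hb₁, hc₁, hs₁, hχm₁, hχb₁, hχ₁, hapx₁⟩ :=
    exists_finite_rank_approx ν hf.measurable hinv Φ₁ hm₁ hC.le hC₁ hu₁ hη0
  obtain ⟨N₂, e₂, c₂, χ₂, he₂, hb₂, hc₂, hs₂, hχm₂, hχb₂, hχ₂, hapx₂⟩ :=
    exists_finite_rank_approx ν hf.measurable hinv Φ₂ hm₂ hC.le hC₂ hu₂ hη0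
  let ψ₁ : M → (Fin d → ℤ) → ℝ := fun y u => ∑ k ∈ Finset.range N₁, e₁ k y * c₁ k u
  let ψ₂ : M → (Fin d → ℤ) → ℝ := fun y u => ∑ k ∈ Finset.range N₂, e₂ k y * c₂ k u
  have hψm₁ : ∀ u, Measurable fun y => ψ₁ y u := fun u =>
    Finset.measurable_fun_sum _ fun k _ => (he₁ k).mul_const _
  have hψm₂ : ∀ u, Measurable fun y => ψ₂ y u := fun u =>
    Finset.measurable_fun_sum _ fun k _ => (he₂ k).mul_const _
  have iχ₁ : Integrable χ₁ ν := integrable_of_forall_abs_le hχm₁ hχb₁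
  have iχ₂ : Integrable χ₂ ν := integrable_of_forall_abs_le hχm₂ hχb₂
  have hmean : ∀ {Φ ψ : M → (Fin d → ℤ) → ℝ} {χ : M → ℝ}, (∀ u, Measurable fun y => Φ y u) →
      (∀ u, Measurable fun y => ψ y u) → (∀ y u, |Φ y u| ≤ C) → (∀ y u, |ψ y u| ≤ C) →
      Integrable χ ν → ∫ y, χ y ∂ν ≤ η → (∀ᵐ y ∂ν, ∀ u, |Φ y u - ψ y u| ≤ χ y) →
      ∀ u, |(∫ y, ψ y u ∂ν) - ∫ y, Φ y u ∂ν| ≤ η := by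
    intro Φ ψ χ hΦ hψ hΦC hψC iχ hχ hapx u
    rw [abs_sub_comm, ← integral_sub (integrable_of_forall_abs_le (hΦ u) fun y => hΦC y u)
      (integrable_of_forall_abs_le (hψ u) fun y => hψC y u)]
    exact ((Real.norm_eq_abs _).symm.trans_le (norm_integral_le_of_norm_le iχ
      (hapx.mono fun y hy => hy u))).trans hχ
  have hmb : ∀ {Φ : M → (Fin d → ℤ) → ℝ}, (∀ y u, |Φ y u| ≤ C) → ∀ u, |∫ y, Φ y u ∂ν| ≤ C := by
    intro Φ hΦ u
    simpa using norm_integral_le_of_norm_le_const (μ := ν) (f := fun y => Φ y u) (C := C)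
      (ae_of_all _ fun y => hΦ y u)
  set δ : ℝ := ε / (2 * (N₁ * N₂ * C * C + 1)) with hδ
  have hδ0 : 0 < δ := by positivity
  have hNδ : N₁ * (N₂ * (C * (C * δ))) ≤ ε / 2 := by
    have h1 : (N₁ * N₂ * C * C + 1) * δ = ε / 2 := by rw [hδ]; field_simp
    linarith
  have hfactor : ∀ᶠ n in atTop, ∀ k ∈ Finset.range N₁, ∀ l ∈ Finset.range N₂,
      ∀ c : (Fin d → ℤ) → ℝ, (∀ u, |c u| ≤ 1) →
        |∫ y, e₁ k y * e₂ l (f^[n] y) * c (tauSum f τ n y) ∂ν -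
          (∫ y, e₁ k y ∂ν) * (∫ y, e₂ l y ∂ν) * ∫ z, c (latticePt (z₀ n) (L n) z) * p z| ≤ δ :=
    (Filter.eventually_all_finset _).2 fun k _ => (Filter.eventually_all_finset _).2 fun l _ =>
      hz₀ _ _ (he₁ k) (he₂ l) ⟨1, hb₁ k⟩ ⟨1, hb₂ l⟩ δ hδ0
  filter_upwards [hfactor, eventually_abs_integral_latticePt_sub_le hpc hp0 hp1 hL
    (G := fun v => ∫ y, Φ₂ y v ∂ν) (hmb hC₂) hg hη0] with n hn hGn u
  have hfn := hf.iterate n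
  have htm := measurable_tauSum hf.measurable hτ n
  have hcomp : ∀ {Φ : M → (Fin d → ℤ) → ℝ}, (∀ u, Measurable fun y => Φ y u) →
      Measurable fun y => Φ (f^[n] y) (u + tauSum f τ n y) := by
    intro Φ hΦ
    have hj : Measurable fun x : M × (Fin d → ℤ) => Φ x.1 x.2 := measurable_from_prod_countable_left hΦ
    exact hj.comp (hfn.measurable.prodMk (htm.const_add u))
  have hX := abs_integral_mul_sub_integral_mul_le (ν := ν) (hm₁ u) (hcomp hm₂) (hψm₁ u)
    (hcomp hψm₂) (fun y => hC₁ y u) (fun y => hC₂ _ _) (fun y => hs₁ y u) (fun y => hs₂ _ _) iχ₁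
    ((hfn.integrable_comp iχ₂.aestronglyMeasurable).2 iχ₂) (hapx₁.mono fun y hy => hy u)
    ((hfn.quasiMeasurePreserving.ae hapx₂).mono fun y hy => hy _)
  have hχf : ∫ y, (χ₂ ∘ f^[n]) y ∂ν = ∫ y, χ₂ y ∂ν := by
    have := integral_map (μ := ν) hfn.aemeasurable (f := χ₂)
      (by rw [hfn.map_eq]; exact iχ₂.aestronglyMeasurable)
    rw [hfn.map_eq] at this
    exact this.symm
  rw [hχf] at hX
  have hF := abs_finite_rank_correlation_sub_le hfn.measurable htm hp (z₀ n) (L n) he₁ he₂ hb₁ hb₂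
    hC hc₁ hc₂ hn u
  have hm := hmean hm₁ hψm₁ hC₁ hs₁ iχ₁ hχ₁ hapx₁ u
  set H : (Fin d → ℤ) → ℝ := fun v => ∫ y, ψ₂ y v ∂ν with hH
  set K : ℝ := ∫ z, H (u + latticePt (z₀ n) (L n) z) * p z with hK
  have hKC : |K| ≤ C := abs_integral_mul_le_of_forall_abs_le hp0 hp hp1 fun z => hmb hs₂ _
  have hKG : |K - ∫ z, (∫ y, Φ₂ y (u + latticePt (z₀ n) (L n) z) ∂ν) * p z| ≤ η := by
    simp only [hK, add_latticePt]
    rw [← integral_sub (integrable_comp_latticePt_mul hp _ _ (hmb hs₂))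
      (integrable_comp_latticePt_mul hp _ _ (G := fun v => ∫ y, Φ₂ y v ∂ν) (hmb hC₂))]
    simp_rw [← sub_mul]
    exact abs_integral_mul_le_of_forall_abs_le hp0 hp hp1 fun z =>
      hmean hm₂ hψm₂ hC₂ hs₂ iχ₂ hχ₂ hapx₂ _
  have hKg := hGn (u + z₀ n)
  simp only [← add_latticePt] at hKg
  have hmC := hmb hC₁ u
  set X := ∫ y, Φ₁ y u * Φ₂ (f^[n] y) (u + tauSum f τ n y) ∂ν
  set X' := ∫ y, ψ₁ y u * ψ₂ (f^[n] y) (u + tauSum f τ n y) ∂ν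
  set m := ∫ y, Φ₁ y u ∂ν
  set m' := ∫ y, ψ₁ y u ∂ν
  set K' := ∫ z, (∫ y, Φ₂ y (u + latticePt (z₀ n) (L n) z) ∂ν) * p z
  have h1 : |X - X'| ≤ C * η + C * η := hX.trans (by gcongr)
  have h2 : |X' - m' * K| ≤ ε / 2 := hF.trans hNδ
  have h3 : |(m' - m) * K| ≤ C * η := by
    rw [abs_mul, mul_comm]
    gcongr
  have h4 : |m * (K - K')| ≤ C * η := by
    rw [abs_mul]
    gcongr
  have h5 : |m * (K' - g)| ≤ C * η := by
    rw [abs_mul]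
    gcongr
  rw [abs_le] at *
  constructor <;> linarith

/-- The lattice points of the cube with lower corner `a` and side length `s`. -/
noncomputable def cubePts {d : ℕ} (a : Fin d → ℝ) (s : ℝ) : Finset (Fin d → ℤ) :=
  Fintype.piFinset fun i => Finset.Icc ⌈a i⌉ ⌊a i + s⌋

theorem mem_cubePts {d : ℕ} {a : Fin d → ℝ} {s : ℝ} {u : Fin d → ℤ} :
    u ∈ cubePts a s ↔ ∀ i, a i ≤ u i ∧ (u i : ℝ) ≤ a i + s := by
  simp [cubePts, Fintype.mem_piFinset, Int.ceil_le, Int.le_floor]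

theorem sum_cubePts_add {d : ℕ} (v : Fin d → ℤ) (s : ℝ) (G : (Fin d → ℤ) → ℝ) :
    ∑ w ∈ cubePts (fun i => (v i : ℝ)) s, G w = ∑ j ∈ cubePts 0 s, G (v + j) := by
  symm
  refine Finset.sum_bij (fun j _ => v + j) (fun j hj => ?_) (fun j _ j' _ h => add_left_cancel h)
    (fun w hw => ⟨w - v, ?_, add_sub_cancel v w⟩) fun _ _ => rfl
  · rw [mem_cubePts] at hj ⊢
    intro i
    have := hj i
    simp only [Pi.zero_apply, Pi.add_apply, Int.cast_add] at this ⊢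
    constructor <;> linarith
  · rw [mem_cubePts] at hw ⊢
    intro i
    have := hw i
    simp only [Pi.zero_apply, Pi.sub_apply, Int.cast_sub] at this ⊢
    constructor <;> linarith

theorem VCube_eq_univ_prod {d : ℕ} (M : Type*) (a : Fin d → ℝ) (s : ℝ) :
    VCube M a s = Set.univ ×ˢ (cubePts a s : Set (Fin d → ℤ)) := by
  ext x
  simp only [VCube, VBox, Set.mem_prod, Set.mem_univ, true_and, Finset.mem_coe, mem_cubePts]
  rfl

/-- Averages over cubes are averages over lattice points of the integrals on the fibres. -/
theorem cubeAvg_skewMeas {d : ℕ} {M : Type*} [MeasurableSpace M] (ν : Measure M)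
    [IsProbabilityMeasure ν] {F : M × (Fin d → ℤ) → ℝ} (hF : ∀ u, Measurable fun y => F (y, u))
    {C : ℝ} (hC : ∀ x, |F x| ≤ C) (c : (Fin d → ℝ) × ℝ) :
    cubeAvg (skewMeas ν) F c =
      ((cubePts c.1 c.2).card : ℝ)⁻¹ * ∑ u ∈ cubePts c.1 c.2, ∫ y, F (y, u) ∂ν := by
  set S := cubePts c.1 c.2
  have hSm : MeasurableSet (S : Set (Fin d → ℤ)) := S.measurableSet
  have hSfin : IsFiniteMeasure ((Measure.count : Measure (Fin d → ℤ)).restrict S) :=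
    ⟨by simp [Measure.count_apply_finset]⟩
  have hμ : (skewMeas ν (VCube M c.1 c.2)).toReal = S.card := by
    rw [VCube_eq_univ_prod, skewMeas, Measure.prod_prod, measure_univ, one_mul,
      Measure.count_apply_finset]
    simp [S]
  have hFm : Measurable F := measurable_from_prod_countable_left hF
  have hI : ∫ x in VCube M c.1 c.2, F x ∂(skewMeas ν) = ∑ u ∈ S, ∫ y, F (y, u) ∂ν := by
    rw [VCube_eq_univ_prod, skewMeas, ← Measure.prod_restrict, Measure.restrict_univ,
      integral_prod_symm _ (Integrable.of_bound hFm.aestronglyMeasurable C (ae_of_all _ hC)),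
      setIntegral_finset]
    · simp [S, Measure.real]
    · exact Integrable.of_bound Measurable.of_discrete.aestronglyMeasurable C
        (ae_of_all _ fun u => by
          simpa using norm_integral_le_of_norm_le_const (μ := ν) (f := fun y => F (y, u)) (C := C)
            (ae_of_all _ fun y => hC _))
  rw [cubeAvg, hμ, hI]

theorem skewT_iterate {d : ℕ} {M : Type*} (f : M → M) (τ : M → Fin d → ℤ) (n : ℕ)
    (x : M × (Fin d → ℤ)) : (skewT f τ)^[n] x = (f^[n] x.1, x.2 + tauSum f τ n x.1) := by
  induction n with
  | zero => simp [tauSum]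
  | succ n ih =>
    rw [Function.iterate_succ_apply', ih, Function.iterate_succ_apply']
    simp [skewT, tauSum, Finset.sum_range_succ, add_assoc]

instance cubeFilter_neBot (d : ℕ) : (cubeFilter d).NeBot :=
  Filter.NeBot.comap_of_surj inferInstance Prod.snd_surjective

theorem abs_limsup_sub_le_and_abs_liminf_sub_le {α : Type*} {l : Filter α} [l.NeBot] {A : α → ℝ}
    {a ε : ℝ} (h : ∀ᶠ c in l, |A c - a| ≤ ε) :
    |limsup A l - a| ≤ ε ∧ |liminf A l - a| ≤ ε := by
  have hle : ∀ᶠ c in l, A c ≤ a + ε := h.mono fun c hc => by linarith [(abs_le.1 hc).2]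
  have hge : ∀ᶠ c in l, a - ε ≤ A c := h.mono fun c hc => by linarith [(abs_le.1 hc).1]
  have ble : l.IsBoundedUnder (· ≤ ·) A := isBoundedUnder_of_eventually_le hle
  have bge : l.IsBoundedUnder (· ≥ ·) A := isBoundedUnder_of_eventually_ge hge
  have h1 : limsup A l ≤ a + ε := limsup_le_of_le bge.isCoboundedUnder_le hle
  have h2 : a - ε ≤ liminf A l := le_liminf_of_le ble.isCoboundedUnder_ge hge
  have h3 : liminf A l ≤ limsup A l := liminf_le_limsup ble bge
  exact ⟨abs_le.2 ⟨by linarith, by linarith⟩, abs_le.2 ⟨by linarith, by linarith⟩⟩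

theorem UniformContinuous.exists_forall_dist_lt_fibre {M Y : Type*} [PseudoMetricSpace M]
    [PseudoMetricSpace Y] {Φ : M × Y → ℝ} (hΦ : UniformContinuous Φ) (ε : ℝ) (hε : ε > 0) :
    ∃ δ > 0, ∀ y y', dist y y' < δ → ∀ u, |Φ (y, u) - Φ (y', u)| ≤ ε := by
  obtain ⟨δ, hδ, h⟩ := Metric.uniformContinuous_iff.1 hΦ ε hε
  refine ⟨δ, hδ, fun y y' hy u => (h ?_).le⟩
  simpa [Prod.dist_eq, hδ] using hy

theorem memGU.exists_finset {d : ℕ} {M : Type*} [MetricSpace M] [MeasurableSpace M] [BorelSpace M]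
    {ν : Measure M} [IsProbabilityMeasure ν] {Φ : M × (Fin d → ℤ) → ℝ} {g : ℝ}
    (hΦ : memGU (skewMeas ν) Φ g) (ε : ℝ) (hε : ε > 0) :
    ∃ Q : Finset (Fin d → ℤ), Q.Nonempty ∧
      ∀ v, |(Q.card : ℝ)⁻¹ * (∑ j ∈ Q, ∫ y, Φ (y, v + j) ∂ν) - g| ≤ ε := by
  obtain ⟨⟨C, hC⟩, huc, hΦ⟩ := hΦ
  obtain ⟨N₀, hN₀⟩ := hΦ ε hε
  have hm : ∀ u, Measurable fun y => Φ (y, u) := fun u =>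
    (huc.continuous.comp (Continuous.prodMk_left u)).measurable
  refine ⟨cubePts 0 (max N₀ 0), ⟨0, mem_cubePts.2 fun i => by simp⟩, fun v => ?_⟩
  have h := hN₀ (fun i => (v i : ℝ)) (max N₀ 0) (le_max_left _ _)
  have havg := cubeAvg_skewMeas ν hm hC ((fun i => (v i : ℝ)), max N₀ 0)
  rw [cubeAvg] at havg
  simp only at havg
  have hcard : ((cubePts (fun i => (v i : ℝ)) (max N₀ 0)).card : ℝ) =
      (cubePts (0 : Fin d → ℝ) (max N₀ 0)).card := by
    simpa using sum_cubePts_add v (max N₀ 0) fun _ => 1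
  rwa [havg, sum_cubePts_add v _ fun u => ∫ y, Φ (y, u) ∂ν, hcard] at h

/-- If the skew product `T(y,z) = (f y, z + τ y)` satisfies a shifted MLLT at
some scale `(L_n)`, then `T` is global-global mixing (of type 3) with respect to `𝔾_U`: for all
pairs `(Φ₁, Φ̄₁), (Φ₂, Φ̄₂) ∈ 𝔾_U`, both the limsup and the liminf over cubes `C` whose side
length tends to `∞` of the averages `(1/μ(V_C)) ∫_{V_C} Φ₁ · (Φ₂ ∘ T^n) dμ` converge to
`Φ̄₁ · Φ̄₂` as `n → ∞`. -/
theorem shifted_mllt_implies_global_global_mixing_GU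
    {d : ℕ} {M : Type*} [MetricSpace M] [LocallyCompactSpace M]
    [MeasurableSpace M] [BorelSpace M]
    (ν : Measure M) [IsProbabilityMeasure ν]
    (f : M → M) (hf : MeasurePreserving f ν ν)
    (τ : M → Fin d → ℤ) (hτ : Measurable τ)
    (L : ℕ → ℝ) (p : (Fin d → ℝ) → ℝ)
    (hMLLT : ShiftedMLLT ν f τ L p)
    (Φ₁ Φ₂ : M × (Fin d → ℤ) → ℝ) (Φbar₁ Φbar₂ : ℝ)
    (hΦ₁ : memGU (skewMeas ν) Φ₁ Φbar₁) (hΦ₂ : memGU (skewMeas ν) Φ₂ Φbar₂) :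
    Tendsto (fun n : ℕ => Filter.limsup
        (cubeAvg (skewMeas ν) (fun x => Φ₁ x * Φ₂ ((skewT f τ)^[n] x))) (cubeFilter d))
      atTop (𝓝 (Φbar₁ * Φbar₂)) ∧
    Tendsto (fun n : ℕ => Filter.liminf
        (cubeAvg (skewMeas ν) (fun x => Φ₁ x * Φ₂ ((skewT f τ)^[n] x))) (cubeFilter d))
      atTop (𝓝 (Φbar₁ * Φbar₂)) := by
  have key : ∀ ε > 0, ∀ᶠ n : ℕ in atTop, ∀ᶠ c in cubeFilter d,
      |cubeAvg (skewMeas ν) (fun x => Φ₁ x * Φ₂ ((skewT f τ)^[n] x)) c - Φbar₁ * Φbar₂| ≤ ε := by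
    intro ε hε
    have hQ := hΦ₂.exists_finset
    obtain ⟨⟨C₁, hC₁⟩, huc₁, havg₁⟩ := hΦ₁
    obtain ⟨⟨C₂, hC₂⟩, huc₂, -⟩ := hΦ₂
    have hm₁ : ∀ u, Measurable fun y => Φ₁ (y, u) := fun u =>
      (huc₁.continuous.comp (Continuous.prodMk_left u)).measurable
    have hm₂ : ∀ u, Measurable fun y => Φ₂ (y, u) := fun u =>
      (huc₂.continuous.comp (Continuous.prodMk_left u)).measurable
    set C := max 1 (max C₁ C₂)
    have hC0 : 0 < C := one_pos.trans_le (le_max_left _ _)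
    have hD₁ : ∀ x, |Φ₁ x| ≤ C := fun x =>
      (hC₁ x).trans ((le_max_left _ _).trans (le_max_right _ _))
    have hD₂ : ∀ x, |Φ₂ x| ≤ C := fun x =>
      (hC₂ x).trans ((le_max_right _ _).trans (le_max_right _ _))
    set η := ε / (2 * (|Φbar₂| + 1))
    have hη : η * |Φbar₂| ≤ ε / 2 := by
      have h1 : η * (|Φbar₂| + 1) = ε / 2 := by simp only [η]; field_simp
      have h2 : 0 < η := by positivity
      linarith
    obtain ⟨N₀, hN₀⟩ := havg₁ η (by positivity)
    filter_upwards [hMLLT.eventually_abs_correlation_sub_le hf hτ (Φ₁ := fun y u => Φ₁ (y, u))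
      (Φ₂ := fun y u => Φ₂ (y, u)) hm₁ hm₂ hC0 (fun y u => hD₁ _) (fun y u => hD₂ _)
      huc₁.exists_forall_dist_lt_fibre huc₂.exists_forall_dist_lt_fibre hQ (half_pos hε)] with n hn
    filter_upwards [(tendsto_comap (f := Prod.snd)).eventually (eventually_ge_atTop N₀)] with c hc
    have hmn : ∀ u, Measurable fun y => Φ₁ (y, u) * Φ₂ ((skewT f τ)^[n] (y, u)) := by
      intro u
      simp only [skewT_iterate]
      exact (hm₁ u).mul (huc₂.continuous.measurable.comp
        ((hf.iterate n).measurable.prodMk ((measurable_tauSum hf.measurable hτ n).const_add u)))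
    have hCn : ∀ x, |Φ₁ x * Φ₂ ((skewT f τ)^[n] x)| ≤ C * C := by
      intro x
      rw [abs_mul]
      gcongr
      exacts [hD₁ _, hD₂ _]
    have hA := cubeAvg_skewMeas ν hmn hCn c
    have hB : |cubeAvg (skewMeas ν) Φ₁ c - Φbar₁| ≤ η := hN₀ c.1 c.2 hc
    rw [cubeAvg_skewMeas ν hm₁ hD₁] at hB
    have hAB : |cubeAvg (skewMeas ν) (fun x => Φ₁ x * Φ₂ ((skewT f τ)^[n] x)) c -
        ((cubePts c.1 c.2).card : ℝ)⁻¹ * (∑ u ∈ cubePts c.1 c.2, ∫ y, Φ₁ (y, u) ∂ν) * Φbar₂| ≤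
        ε / 2 := by
      rw [hA, mul_assoc, ← mul_sub, Finset.sum_mul, ← Finset.sum_sub_distrib, abs_mul, abs_inv,
        Nat.abs_cast]
      have hsum : |∑ u ∈ cubePts c.1 c.2, ((∫ y, Φ₁ (y, u) * Φ₂ ((skewT f τ)^[n] (y, u)) ∂ν) -
          (∫ y, Φ₁ (y, u) ∂ν) * Φbar₂)| ≤ (cubePts c.1 c.2).card * (ε / 2) := by
        refine (Finset.abs_sum_le_sum_abs _ _).trans ?_
        rw [← nsmul_eq_mul]
        refine Finset.sum_le_card_nsmul _ _ _ fun u _ => ?_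
        simp only [skewT_iterate]
        exact hn u
      rcases (Nat.cast_nonneg (α := ℝ) (cubePts c.1 c.2).card).eq_or_lt with h0 | h0
      · rw [← h0, inv_zero, zero_mul]
        exact (half_pos hε).le
      · rwa [inv_mul_le_iff₀ h0]
    refine (abs_sub_le _ _ _).trans ((add_le_add hAB ?_).trans (add_halves ε).le)
    rw [← sub_mul, abs_mul]
    exact (mul_le_mul_of_nonneg_right hB (abs_nonneg _)).trans hη
  constructor <;> refine Metric.tendsto_nhds.2 fun ε hε => (key (ε / 2) (half_pos hε)).mono
    fun n hn => ?_
  · exact (abs_limsup_sub_le_and_abs_liminf_sub_le hn).1.trans_lt (half_lt_self hε)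
  · exact (abs_limsup_sub_le_and_abs_liminf_sub_le hn).2.trans_lt (half_lt_self hε)
end

section
/- Suppose T satisfies the mixing local limit theorem (MLLT) at scale (L_n) with limiting density p. Then the convergence in the MLLT is uniform over compact sets of observables: for every compact subset 𝒦 of the space of bounded continuous functions on M equipped with the supremum norm, every sequence (z_n⁰) in ℤ^d with z_n⁰/L_n → 0 and every K < ∞, sup_{φ₁, φ₂ ∈ 𝒦} sup_{z ∈ ℝ^d, |z| ≤ K} | L_n^d ∫_M φ₁(y) φ₂(f^n(y)) 1[τ_n(y) = z_n⁰ + ⌊z L_n⌋] dν(y) − ν(φ₁) ν(φ₂) p(z) | → 0 as n → ∞. -/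
open MeasureTheory Filter Topology

/-- The difference of two products of reals, estimated factor by factor. -/
theorem abs_mul_sub_mul_le_of_abs_sub_le {x y a b A B δ : ℝ} (hx : |x - a| ≤ δ) (hy : |y - b| ≤ δ)
    (hδ : δ ≤ 1) (ha : |a| ≤ A) (hb : |b| ≤ B) :
    |x * y - a * b| ≤ δ * (A + B + 1) := by
  have hδ0 : 0 ≤ δ := (abs_nonneg _).trans hx
  have hy' : |y| ≤ B + 1 := by
    have := abs_add_le (y - b) b
    rw [sub_add_cancel] at this
    linarith
  calc |x * y - a * b| = |(x - a) * y + a * (y - b)| := by congr 1; ring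
    _ ≤ |x - a| * |y| + |a| * |y - b| := by
      rw [← abs_mul, ← abs_mul]; exact abs_add_le _ _
    _ ≤ δ * (B + 1) + A * δ := by gcongr; exact (abs_nonneg _).trans ha
    _ = δ * (A + B + 1) := by ring

theorem exists_forall_rnorm_le_abs_le {d : ℕ} {p : (Fin d → ℝ) → ℝ} (hp : Continuous p) (K : ℝ) :
    ∃ P, ∀ z, rnorm z ≤ K → |p z| ≤ P := by
  obtain ⟨P, hP⟩ := (isCompact_closedBall (0 : Fin d → ℝ) |K|).exists_bound_of_continuousOn
    hp.continuousOn
  refine ⟨P, fun z hz => hP z ?_⟩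
  rw [mem_closedBall_zero_iff, pi_norm_le_iff_of_nonneg (abs_nonneg K)]
  intro i
  calc ‖z i‖ = Real.sqrt ((z i) ^ 2) := (Real.sqrt_sq_eq_abs _).symm
    _ ≤ rnorm z := Real.sqrt_le_sqrt
      (Finset.single_le_sum (f := fun i => (z i) ^ 2) (fun i _ => sq_nonneg _) (Finset.mem_univ i))
    _ ≤ |K| := hz.trans (le_abs_self K)

theorem abs_integral_sub_integral_le_dist {M : Type*} [TopologicalSpace M] [MeasurableSpace M]
    [OpensMeasurableSpace M] (ν : Measure M) [IsProbabilityMeasure ν]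
    (φ a : BoundedContinuousFunction M ℝ) :
    |(∫ y, φ y ∂ν) - ∫ y, a y ∂ν| ≤ dist φ a := by
  rw [← integral_sub (BoundedContinuousFunction.integrable ν φ)
    (BoundedContinuousFunction.integrable ν a), dist_eq_norm]
  exact (φ - a).norm_integral_le_norm ν

/-- Restricted correlations of bounded continuous observables are Lipschitz in the observables,
with a constant proportional to the restricted correlation of the constant `1`. -/
theorem abs_integral_ite_mul_comp_sub_le {M : Type*} [TopologicalSpace M] [MeasurableSpace M]
    [OpensMeasurableSpace M] (ν : Measure M) [IsProbabilityMeasure ν] {g : M → M}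
    (hg : Measurable g) {q : M → Prop} [DecidablePred q] (hq : MeasurableSet {y | q y})
    {φ ψ a b : BoundedContinuousFunction M ℝ} {δ : ℝ} (hδ : δ ≤ 1)
    (hφ : dist φ a ≤ δ) (hψ : dist ψ b ≤ δ) :
    |(∫ y, (if q y then φ y * ψ (g y) else 0) ∂ν) -
        ∫ y, (if q y then a y * b (g y) else 0) ∂ν| ≤
      δ * (‖a‖ + ‖b‖ + 1) * ∫ y, (if q y then (1 : ℝ) * 1 else 0) ∂ν := by
  have hint (u v : BoundedContinuousFunction M ℝ) :
      Integrable (fun y => if q y then u y * v (g y) else 0) ν := by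
    refine Integrable.of_bound (C := ‖u‖ * ‖v‖)
      (Measurable.aestronglyMeasurable (Measurable.ite hq
        (u.continuous.measurable.mul (v.continuous.measurable.comp hg)) measurable_const))
      (Eventually.of_forall fun y => ?_)
    split_ifs
    · rw [norm_mul]
      exact mul_le_mul (u.norm_coe_le_norm _) (v.norm_coe_le_norm _) (norm_nonneg _) (norm_nonneg _)
    · rw [norm_zero]; positivity
  rw [← integral_sub (hint φ ψ) (hint a b), ← integral_const_mul, ← Real.norm_eq_abs]
  refine norm_integral_le_of_norm_le (Integrable.const_mul ?_ _) (Eventually.of_forall fun y => ?_)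
  · simpa using hint 1 1
  · by_cases h : q y
    · simp only [h, if_true, mul_one, Real.norm_eq_abs]
      exact abs_mul_sub_mul_le_of_abs_sub_le ((φ.dist_coe_le_dist y).trans hφ)
        ((ψ.dist_coe_le_dist (g y)).trans hψ) hδ (a.norm_coe_le_norm _) (b.norm_coe_le_norm _)
    · simp [h]

/-- Under the MLLT, the convergence is uniform over compact subsets `𝒦` of the
space of bounded continuous functions on `M` (with the supremum norm): for every compact
`𝒦 ⊆ C_b(M, ℝ)`, every sequence `(z_n⁰)` with `z_n⁰ / L_n → 0`, and every `K < ∞`,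
`sup_{φ₁, φ₂ ∈ 𝒦} sup_{|z| ≤ K} |L_n^d ∫ φ₁ (φ₂ ∘ f^n) 1[τ_n = z_n⁰ + ⌊z L_n⌋] dν
  − ν(φ₁) ν(φ₂) p(z)| → 0`. -/
theorem mllt_uniform_over_compact_observables
    {d : ℕ} {M : Type*} [MetricSpace M] [LocallyCompactSpace M]
    [MeasurableSpace M] [BorelSpace M]
    (ν : Measure M) [IsProbabilityMeasure ν]
    (f : M → M) (hf : MeasurePreserving f ν ν)
    (τ : M → Fin d → ℤ) (hτ : Measurable τ)
    (L : ℕ → ℝ) (p : (Fin d → ℝ) → ℝ)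
    (hMLLT : MLLT ν f τ L p)
    (𝒦 : Set (BoundedContinuousFunction M ℝ)) (h𝒦 : IsCompact 𝒦)
    (z0 : ℕ → Fin d → ℤ)
    (hz0 : Tendsto (fun n => fun i => (z0 n i : ℝ) / L n) atTop (𝓝 0))
    (K : ℝ) :
    ∀ ε > (0 : ℝ), ∃ N, ∀ n ≥ N, ∀ φ₁ ∈ 𝒦, ∀ φ₂ ∈ 𝒦, ∀ z : Fin d → ℝ, rnorm z ≤ K →
      |(L n) ^ d *
          (∫ y, (if tauSum f τ n y = z0 n + (fun i => ⌊z i * L n⌋) then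
            φ₁ y * φ₂ (f^[n] y) else 0) ∂ν) -
        (∫ y, φ₁ y ∂ν) * (∫ y, φ₂ y ∂ν) * p z| ≤ ε := by
  obtain ⟨hL, hp, -, -, hlim⟩ := hMLLT
  intro ε hε
  obtain ⟨P, hP⟩ := exists_forall_rnorm_le_abs_le hp K
  obtain ⟨N₁, hN₁⟩ := hlim (fun _ => 1) (fun _ => 1) continuous_const continuous_const
    ⟨1, by simp⟩ ⟨1, by simp⟩ z0 hz0 K 1 one_pos
  obtain ⟨N₂, hN₂⟩ := eventually_atTop.1 (hL.eventually_ge_atTop 0)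
  suffices h : ∃ N, ∀ n ≥ N, ∀ x ∈ 𝒦 ×ˢ 𝒦, ∀ z : Fin d → ℝ, rnorm z ≤ K →
      |(L n) ^ d *
          (∫ y, (if tauSum f τ n y = z0 n + (fun i => ⌊z i * L n⌋) then
            x.1 y * x.2 (f^[n] y) else 0) ∂ν) -
        (∫ y, x.1 y ∂ν) * (∫ y, x.2 y ∂ν) * p z| ≤ ε by
    obtain ⟨N, hN⟩ := h
    exact ⟨N, fun n hn φ₁ h₁ φ₂ h₂ => hN n hn (φ₁, φ₂) ⟨h₁, h₂⟩⟩
  refine (h𝒦.prod h𝒦).induction_on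
    (p := fun S => ∃ N, ∀ n ≥ N, ∀ x ∈ S, ∀ z : Fin d → ℝ, rnorm z ≤ K →
      |(L n) ^ d *
          (∫ y, (if tauSum f τ n y = z0 n + (fun i => ⌊z i * L n⌋) then
            x.1 y * x.2 (f^[n] y) else 0) ∂ν) -
        (∫ y, x.1 y ∂ν) * (∫ y, x.2 y ∂ν) * p z| ≤ ε) ⟨0, by simp⟩ ?_ ?_ ?_
  · rintro S T hST ⟨N, hN⟩
    exact ⟨N, fun n hn x hx => hN n hn x (hST hx)⟩
  · rintro S T ⟨N, hN⟩ ⟨N', hN'⟩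
    refine ⟨max N N', fun n hn x hx => hx.elim (hN n (le_of_max_le_left hn) x)
      (hN' n (le_of_max_le_right hn) x)⟩
  rintro ⟨a, b⟩ -
  obtain ⟨N₃, hN₃⟩ := hlim a b a.continuous b.continuous ⟨‖a‖, a.norm_coe_le_norm⟩
    ⟨‖b‖, b.norm_coe_le_norm⟩ z0 hz0 K (ε / 2) (half_pos hε)
  set R := ‖a‖ + ‖b‖ + 1 with hR
  have hR0 : 0 < R := by positivity
  obtain ⟨δ, hδ0, hδ1, hδ⟩ : ∃ δ : ℝ, 0 < δ ∧ δ ≤ 1 ∧ δ * R * (2 * |P| + 1) ≤ ε / 2 := by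
    have hD : 0 < R * (2 * |P| + 1) := by positivity
    refine ⟨min 1 (ε / 2 / (R * (2 * |P| + 1))), by positivity, min_le_left _ _, ?_⟩
    rw [mul_assoc, ← le_div_iff₀ hD]
    exact min_le_right _ _
  refine ⟨_, mem_nhdsWithin_of_mem_nhds (Metric.closedBall_mem_nhds (a, b) hδ0),
    max N₁ (max N₂ N₃), ?_⟩
  rintro n hn ⟨φ, ψ⟩ hx z hz
  obtain ⟨hφ, hψ⟩ : dist φ a ≤ δ ∧ dist ψ b ≤ δ := max_le_iff.1 hx
  simp only [ge_iff_le, max_le_iff] at hn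
  have h₁ := hN₁ n hn.1 z hz
  have h₃ := hN₃ n hn.2.2 z hz
  have hLn : 0 ≤ L n ^ d := pow_nonneg (hN₂ n hn.2.1) d
  have hcorr := abs_integral_ite_mul_comp_sub_le ν (hf.measurable.iterate n)
    (q := fun y => tauSum f τ n y = z0 n + fun i => ⌊z i * L n⌋)
    (measurable_tauSum hf.measurable hτ n (measurableSet_singleton _)) hδ1 hφ hψ
  have hmean := abs_mul_sub_mul_le_of_abs_sub_le
    ((abs_integral_sub_integral_le_dist ν φ a).trans hφ)
    ((abs_integral_sub_integral_le_dist ν ψ b).trans hψ) hδ1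
    (a.norm_integral_le_norm ν) (b.norm_integral_le_norm ν)
  have hPz : |p z| ≤ |P| := (hP z hz).trans (le_abs_self P)
  rw [← hR] at hcorr hmean
  simp only [integral_const, probReal_univ, smul_eq_mul, one_mul] at h₁
  simp only [one_mul] at hcorr
  set I := ∫ y, (if tauSum f τ n y = z0 n + (fun i => ⌊z i * L n⌋) then (1 : ℝ) else 0) ∂ν
  set A := ∫ y, (if tauSum f τ n y = z0 n + (fun i => ⌊z i * L n⌋) then
    φ y * ψ (f^[n] y) else 0) ∂ν
  set B := ∫ y, (if tauSum f τ n y = z0 n + (fun i => ⌊z i * L n⌋) then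
    a y * b (f^[n] y) else 0) ∂ν
  have hI : L n ^ d * I ≤ |P| + 1 := by
    linarith [(abs_le.1 h₁).2, le_abs_self (p z)]
  have hA : |L n ^ d * (A - B)| ≤ δ * R * (|P| + 1) := by
    rw [abs_mul, abs_of_nonneg hLn]
    calc L n ^ d * |A - B| ≤ L n ^ d * (δ * R * I) := by gcongr
      _ = δ * R * (L n ^ d * I) := by ring
      _ ≤ δ * R * (|P| + 1) := by gcongr
  have hM : |((∫ y, φ y ∂ν) * (∫ y, ψ y ∂ν) - (∫ y, a y ∂ν) * (∫ y, b y ∂ν)) * p z| ≤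
      δ * R * |P| := by
    rw [abs_mul]
    gcongr
  rw [abs_le] at hA hM h₃ ⊢
  constructor <;> linarith [hA.1, hA.2, hM.1, hM.2, h₃.1, h₃.2]
end

section
/- Let (X, 𝒜, μ) be a σ-finite measure space with μ(X) = ∞ and let T : X → X be a conservative ergodic measure-preserving transformation. Then for all measurable sets A and B of finite μ-measure, (1/N) ∑_{n=1}^N μ(A ∩ T^{−n}B) → 0 as N → ∞. In particular, for every ε > 0 there exists n with μ(A ∩ T^{−n}B) < ε. -/
open MeasureTheory Filter Topology
open scoped symmDiff

/-- For an ergodic map of an infinite measure space, the only invariant element of `Lp`,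
`p < ∞`, is zero. -/
theorem Ergodic.eq_zero_of_compMeasurePreserving_eq {X E : Type*} [MeasurableSpace X]
    {μ : Measure X} [NormedAddCommGroup E] {p : ENNReal} {T : X → X} (hT : Ergodic T μ)
    (hinf : μ Set.univ = ⊤) (hp₀ : p ≠ 0) (hp : p ≠ ⊤) {f : Lp E p μ}
    (hf : Lp.compMeasurePreserving T hT.toMeasurePreserving f = f) : f = 0 := by
  have hfT : f ∘ T =ᵐ[μ] f :=
    (Lp.coeFn_compMeasurePreserving f hT.toMeasurePreserving).symm.trans (by rw [hf])
  obtain ⟨c, hc⟩ := hT.ae_eq_const_of_ae_eq_comp_ae (Lp.aestronglyMeasurable f) hfT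
  have hmem : MemLp (fun _ : X ↦ c) p μ := (Lp.memLp f).ae_eq hc
  rcases (memLp_const_iff_enorm (by simp) hp₀ hp).1 hmem with h | h
  · rw [Lp.eq_zero_iff_ae_eq_zero]
    filter_upwards [hc] with x hx
    simpa [hx] using h
  · simp [hinf] at h

/-- For an ergodic map of an infinite measure space, the correlations of two sets of finite
measure tend to zero in the Cesàro sense. -/
theorem Ergodic.tendsto_cesaro_correlations_zero {X : Type*} [MeasurableSpace X]
    {μ : Measure X} {T : X → X} (hT : Ergodic T μ) (hinf : μ Set.univ = ⊤) {A B : Set X}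
    (hA : MeasurableSet A) (hB : MeasurableSet B) (hAfin : μ A ≠ ⊤) (hBfin : μ B ≠ ⊤) :
    Tendsto (fun N : ℕ ↦ (N : ℝ)⁻¹ * ∑ n ∈ Finset.range N, μ.real (A ∩ T^[n] ⁻¹' B))
      atTop (𝓝 0) := by
  have hTμ := hT.toMeasurePreserving
  let U : Lp ℝ 2 μ →L[ℝ] Lp ℝ 2 μ :=
    (Lp.compMeasurePreservingₗᵢ ℝ T hTμ).toContinuousLinearMap
  have hUiter (n : ℕ) (f : Lp ℝ 2 μ) :
      U^[n] f = Lp.compMeasurePreserving T^[n] (hTμ.iterate n) f := by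
    rw [← Lp.compMeasurePreserving_iterate]
    rfl
  have hproj (f : Lp ℝ 2 μ) :
      ((U.eqLocus (1 : Lp ℝ 2 μ →L[ℝ] Lp ℝ 2 μ)).orthogonalProjectionOnto f : Lp ℝ 2 μ) = 0 :=
    hT.eq_zero_of_compMeasurePreserving_eq hinf two_ne_zero ENNReal.ofNat_ne_top
      ((U.eqLocus (1 : Lp ℝ 2 μ →L[ℝ] Lp ℝ 2 μ)).orthogonalProjectionOnto f).2
  have hmean := U.tendsto_birkhoffAverage_orthogonalProjection
    (LinearIsometry.norm_toContinuousLinearMap_le _) (indicatorConstLp 2 hB hBfin (1 : ℝ))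
  rw [hproj] at hmean
  have hinner := Filter.Tendsto.inner (𝕜 := ℝ)
    (tendsto_const_nhds (x := indicatorConstLp 2 hA hAfin (1 : ℝ))) hmean
  rw [inner_zero_right] at hinner
  refine hinner.congr fun N ↦ ?_
  simp only [birkhoffAverage, birkhoffSum, id, inner_smul_right, inner_sum]
  congr 1
  refine Finset.sum_congr rfl fun n _ ↦ ?_
  have hBn : μ (T^[n] ⁻¹' B) ≠ ⊤ := by
    rwa [(hTμ.iterate n).measure_preimage hB.nullMeasurableSet]
  rw [hUiter, Lp.indicatorConstLp_compMeasurePreserving,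
    L2.real_inner_indicatorConstLp_one_indicatorConstLp_one (hμt := hBn)]

/-- Let `(X, 𝒜, μ)` be a σ-finite measure space of infinite total measure and
`T` a conservative ergodic measure-preserving transformation.  Then for all measurable sets
`A, B` of finite measure, `(1/N) ∑_{n=1}^N μ(A ∩ T^{-n}B) → 0`; in particular for every `ε > 0`
there is `n` with `μ(A ∩ T^{-n}B) < ε`. -/
theorem cesaro_correlations_tendsto_zero_of_conservative_ergodic
    {X : Type*} [MeasurableSpace X] (μ : Measure X) [SigmaFinite μ]
    (hinf : μ Set.univ = ⊤)
    (T : X → X) (hTmeas : Measurable T) (hTpres : MeasurePreserving T μ μ)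
    (hcons : ∀ W : Set X, MeasurableSet W →
      (∀ m n : ℕ, m ≠ n → Disjoint (T^[m] ⁻¹' W) (T^[n] ⁻¹' W)) → μ W = 0)
    (herg : ∀ E : Set X, MeasurableSet E → μ (E ∆ (T ⁻¹' E)) = 0 →
      μ E = 0 ∨ μ Eᶜ = 0)
    (A B : Set X) (hA : MeasurableSet A) (hB : MeasurableSet B)
    (hAfin : μ A < ⊤) (hBfin : μ B < ⊤) :
    Tendsto (fun N : ℕ =>
        (1 / (N : ℝ)) * ∑ n ∈ Finset.Icc 1 N, (μ (A ∩ T^[n] ⁻¹' B)).toReal)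
      atTop (𝓝 0) ∧
    ∀ ε > (0 : ℝ), ∃ n : ℕ, μ (A ∩ T^[n] ⁻¹' B) < ENNReal.ofReal ε := by
  have hT : Ergodic T μ :=
    { hTpres with
      aeconst_set := fun s hs hTs ↦ by
        rw [eventuallyConst_set']
        rcases herg s hs (by simp [hTs]) with h | h
        · exact .inl (ae_eq_empty.2 h)
        · exact .inr (ae_eq_univ.2 h) }
  have htend : Tendsto (fun N : ℕ =>
      (1 / (N : ℝ)) * ∑ n ∈ Finset.Icc 1 N, (μ (A ∩ T^[n] ⁻¹' B)).toReal) atTop (𝓝 0) := by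
    refine (hT.tendsto_cesaro_correlations_zero hinf hA (hTmeas hB) hAfin.ne
      (by rw [hTpres.measure_preimage hB.nullMeasurableSet]; exact hBfin.ne)).congr fun N ↦ ?_
    rw [one_div, ← Finset.Ico_add_one_right_eq_Icc, Finset.sum_Ico_eq_sum_range,
      Nat.add_sub_cancel]
    simp only [Nat.add_comm 1, Function.iterate_succ', Set.preimage_comp, Measure.real]
  refine ⟨htend, fun ε hε ↦ ?_⟩
  by_contra! hle
  have hterm (n : ℕ) : ε ≤ (μ (A ∩ T^[n] ⁻¹' B)).toReal :=
    (ENNReal.ofReal_le_iff_le_toReal (measure_ne_top_of_subset Set.inter_subset_left hAfin.ne)).1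
      (hle n)
  obtain ⟨N, hN, hN₀⟩ := ((htend.eventually_lt_const hε).and (eventually_gt_atTop 0)).exists
  have hN' : (0 : ℝ) < N := by exact_mod_cast hN₀
  have hsum := Finset.card_nsmul_le_sum (Finset.Icc 1 N) _ ε fun n _ ↦ hterm n
  rw [Nat.card_Icc, Nat.add_sub_cancel, nsmul_eq_mul] at hsum
  rw [one_div, inv_mul_lt_iff₀ hN'] at hN
  exact hN.not_ge hsum
end

section
/- Let (X, 𝒜, μ) be a σ-finite measure space with μ(X) = ∞ and let T : X → X be a measure-preserving transformation. Assume that either (a) for every measurable set B with μ(B) < ∞, for μ-almost every x ∈ X, T^n x ∈ B for only finitely many n ≥ 0; or (b) T is conservative and ergodic. Then for all measurable sets A and B of finite μ-measure and every ε > 0, there exists n ∈ ℕ with μ( { x ∈ A : T^n x ∈ B } ) < ε. -/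
open MeasureTheory Filter Topology
open scoped symmDiff

/-- In an infinite measure space, an `L²` function invariant under an ergodic map vanishes. -/
lemma Ergodic.Lp_eq_zero_of_compMeasurePreserving_eq {X : Type*} [MeasurableSpace X]
    {μ : Measure X} {T : X → X} (hT : Ergodic T μ) (hinf : μ Set.univ = ⊤) {g : Lp ℝ 2 μ}
    (hg : Lp.compMeasurePreserving T hT.toMeasurePreserving g = g) : g = 0 := by
  have hcomp : g ∘ T =ᵐ[μ] g := by
    simpa only [hg] using (Lp.coeFn_compMeasurePreserving g hT.toMeasurePreserving).symm
  obtain ⟨c, hc⟩ := hT.ae_eq_const_of_ae_eq_comp_ae (Lp.aestronglyMeasurable g) hcomp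
  have hc0 : c = 0 := by
    have hmem : MemLp (fun _ : X ↦ c) 2 μ := (memLp_congr_ae hc).1 (Lp.memLp g)
    simpa [hinf] using (memLp_const_iff (by simp) (by simp)).1 hmem
  rw [Lp.eq_zero_iff_ae_eq_zero]
  subst hc0
  exact hc

/-- For an ergodic map of an infinite measure space, the Cesàro averages of the correlations of
two sets of finite measure tend to zero. -/
lemma Ergodic.tendsto_average_measureReal_inter_preimage_iterate {X : Type*} [MeasurableSpace X]
    {μ : Measure X} {T : X → X} (hT : Ergodic T μ) (hinf : μ Set.univ = ⊤) {A B : Set X}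
    (hA : MeasurableSet A) (hB : MeasurableSet B) (hAfin : μ A ≠ ⊤) (hBfin : μ B ≠ ⊤) :
    Tendsto (fun n : ℕ ↦ (n : ℝ)⁻¹ * ∑ k ∈ Finset.range n, μ.real (A ∩ T^[k] ⁻¹' B))
      atTop (𝓝 0) := by
  have hmp := hT.toMeasurePreserving
  let U : Lp ℝ 2 μ →ₗᵢ[ℝ] Lp ℝ 2 μ := Lp.compMeasurePreservingₗᵢ ℝ T hmp
  let V : Lp ℝ 2 μ →L[ℝ] Lp ℝ 2 μ := U.toContinuousLinearMap
  let b : Lp ℝ 2 μ := indicatorConstLp 2 hB hBfin (1 : ℝ)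
  let a : Lp ℝ 2 μ := indicatorConstLp 2 hA hAfin (1 : ℝ)
  have hpre (k : ℕ) : μ (T^[k] ⁻¹' B) ≠ ⊤ := by
    rwa [(hmp.iterate k).measure_preimage hB.nullMeasurableSet]
  have hiter (k : ℕ) : V^[k] b =
      indicatorConstLp 2 ((hmp.iterate k).measurable hB) (hpre k) (1 : ℝ) := by
    induction k with
    | zero => rfl
    | succ k ih =>
      rw [Function.iterate_succ_apply', ih]
      exact Lp.indicatorConstLp_compMeasurePreserving _ _ _ hmp
  have hcorr (k : ℕ) : inner ℝ a (V^[k] b) = μ.real (A ∩ T^[k] ⁻¹' B) := by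
    rw [hiter]
    exact L2.real_inner_indicatorConstLp_one_indicatorConstLp_one hA _ hAfin _
  have hlim := V.tendsto_birkhoffAverage_orthogonalProjection U.norm_toContinuousLinearMap_le b
  have hfixed (g : LinearMap.eqLocus (V : Lp ℝ 2 μ →ₗ[ℝ] Lp ℝ 2 μ)
      (1 : Lp ℝ 2 μ →L[ℝ] Lp ℝ 2 μ)) : (g : Lp ℝ 2 μ) = 0 :=
    hT.Lp_eq_zero_of_compMeasurePreserving_eq hinf g.2
  rw [hfixed] at hlim
  simpa [birkhoffAverage, birkhoffSum, inner_smul_right, inner_sum, hcorr] using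
    (tendsto_const_nhds (x := a)).inner (𝕜 := ℝ) hlim

/-- For an ergodic map of an infinite measure space, two sets of finite measure have
arbitrarily small correlations. -/
lemma Ergodic.exists_measure_inter_preimage_iterate_lt {X : Type*} [MeasurableSpace X]
    {μ : Measure X} {T : X → X} (hT : Ergodic T μ) (hinf : μ Set.univ = ⊤) {A B : Set X}
    (hA : MeasurableSet A) (hB : MeasurableSet B) (hAfin : μ A ≠ ⊤) (hBfin : μ B ≠ ⊤)
    {ε : ℝ} (hε : 0 < ε) : ∃ n : ℕ, μ (A ∩ T^[n] ⁻¹' B) < ENNReal.ofReal ε := by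
  by_contra! h
  have hreal (k : ℕ) : ε ≤ μ.real (A ∩ T^[k] ⁻¹' B) :=
    (ENNReal.ofReal_le_iff_le_toReal (measure_inter_ne_top_of_left_ne_top hAfin)).1 (h k)
  have hlim := hT.tendsto_average_measureReal_inter_preimage_iterate hinf hA hB hAfin hBfin
  refine hε.not_ge (ge_of_tendsto hlim ?_)
  filter_upwards [eventually_gt_atTop 0] with n hn
  have hn' : (0 : ℝ) < n := Nat.cast_pos.2 hn
  rw [le_inv_mul_iff₀ hn']
  simpa using Finset.card_nsmul_le_sum (Finset.range n) _ ε fun k _ ↦ hreal k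

/-- If almost every orbit visits `B` finitely often, then the measures of the sets of points of `A`
lying in `B` at time `n` tend to zero. -/
lemma MeasureTheory.tendsto_measure_inter_preimage_iterate_of_ae_finite {X : Type*}
    [MeasurableSpace X] {μ : Measure X} {T : X → X} (hT : Measurable T) {A B : Set X}
    (hA : MeasurableSet A) (hB : MeasurableSet B) (hAfin : μ A ≠ ⊤)
    (h : ∀ᵐ x ∂μ, Set.Finite {n : ℕ | T^[n] x ∈ B}) :
    Tendsto (fun n : ℕ ↦ μ (A ∩ T^[n] ⁻¹' B)) atTop (𝓝 0) := by
  rw [← measure_empty (μ := μ)]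
  refine tendsto_measure_of_ae_tendsto_indicator atTop MeasurableSet.empty
    (fun n ↦ hA.inter (hT.iterate n hB)) hA hAfin
    (Eventually.of_forall fun n ↦ Set.inter_subset_left) ?_
  filter_upwards [h] with x hx
  rw [← Nat.cofinite_eq_atTop]
  filter_upwards [hx.compl_mem_cofinite] with n hn
  exact iff_of_false (fun hmem ↦ hn hmem.2) (Set.notMem_empty x)

/-- Let `(X, 𝒜, μ)` be a σ-finite measure space of infinite total measure and
`T` a measure-preserving transformation.  Assume either (a) for every measurable `B` of finite
measure, `μ`-a.e. orbit visits `B` only finitely often, or (b) `T` is conservative and ergodic.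
Then for all measurable `A, B` of finite measure and every `ε > 0` there is `n` with
`μ({x ∈ A : T^n x ∈ B}) < ε`. -/
theorem eventually_small_return_measure_of_dissipative_or_conservative_ergodic
    {X : Type*} [MeasurableSpace X] (μ : Measure X) [SigmaFinite μ]
    (hinf : μ Set.univ = ⊤)
    (T : X → X) (hTmeas : Measurable T) (hTpres : MeasurePreserving T μ μ)
    (hdichotomy :
      (∀ B : Set X, MeasurableSet B → μ B < ⊤ →
        ∀ᵐ x ∂μ, Set.Finite {n : ℕ | T^[n] x ∈ B}) ∨
      ((∀ W : Set X, MeasurableSet W →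
          (∀ m n : ℕ, m ≠ n → Disjoint (T^[m] ⁻¹' W) (T^[n] ⁻¹' W)) → μ W = 0) ∧
        (∀ E : Set X, MeasurableSet E → μ (E ∆ (T ⁻¹' E)) = 0 →
          μ E = 0 ∨ μ Eᶜ = 0)))
    (A B : Set X) (hA : MeasurableSet A) (hB : MeasurableSet B)
    (hAfin : μ A < ⊤) (hBfin : μ B < ⊤) :
    ∀ ε > (0 : ℝ), ∃ n : ℕ, μ {x ∈ A | T^[n] x ∈ B} < ENNReal.ofReal ε := by
  intro ε hε
  rcases hdichotomy with hfinite | ⟨-, hergodic⟩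
  · exact ((tendsto_measure_inter_preimage_iterate_of_ae_finite hTmeas hA hB hAfin.ne
      (hfinite B hB hBfin)).eventually_lt_const (ENNReal.ofReal_pos.2 hε)).exists
  · have hT : Ergodic T μ :=
      { toMeasurePreserving := hTpres
        aeconst_set := fun s hs hTs ↦ by
          rw [eventuallyConst_set', ae_eq_empty, ae_eq_univ]
          exact hergodic s hs (by simp [hTs]) }
    exact hT.exists_measure_inter_preimage_iterate_lt hinf hA hB hAfin.ne hBfin.ne hε
end
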